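/- arXiv:1512.09040 — 2 statements merged into one kernel-verified Lean document; each statement's English description precedes it below -/
import Mathlib

section
/- In a good drawing of K_n, if three pairwise independent edges e, f, g pairwise cross, then the simple closed curve formed by the three segments between the crossing points ×(e,f), ×(e,g), ×(f,g) bounds two discs, and at most one of them contains no endpoint of e, f, g. -/
open Set unitInterval

noncomputable section

/-- The 2-sphere, realized as the unit sphere in `ℝ³`. -/
abbrev Sph : Type := ↥(Metric.sphere (0 : EuclideanSpace ℝ (Fin 3)) 1)

/-- A drawing of the complete graph `K_n` in the sphere: an injective placement of the
vertices together with, for each ordered pair of distinct vertices, a simple arc joining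
them (the same arc in both directions), meeting the vertex set only at its endpoints. -/
structure SphereDrawing (n : ℕ) where
  vert : Fin n → Sph
  vert_inj : Function.Injective vert
  edge : ∀ i j : Fin n, i ≠ j → Path (vert i) (vert j)
  edge_symm : ∀ (i j : Fin n) (h : i ≠ j), edge j i h.symm = (edge i j h).symm
  edge_inj : ∀ (i j : Fin n) (h : i ≠ j), Function.Injective ⇑(edge i j h)
  edge_vert : ∀ (i j : Fin n) (h : i ≠ j),
    Set.range ⇑(edge i j h) ∩ Set.range vert = {vert i, vert j}

namespace SphereDrawing

variable {n : ℕ}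

/-- The point set of the edge between `i` and `j` (empty if `i = j`). -/
def arc (D : SphereDrawing n) (i j : Fin n) : Set Sph :=
  ⋃ h : i ≠ j, Set.range ⇑(D.edge i j h)

/-- The open interior of an edge: its point set minus all vertices. -/
def inner (D : SphereDrawing n) (i j : Fin n) : Set Sph :=
  D.arc i j \ Set.range D.vert

/-- A good drawing: no two edges with a common end cross; no two (independent) edges
cross more than once; and no three edges pass through a common non-vertex point. -/
structure IsGood (D : SphereDrawing n) : Prop where
  adj : ∀ i j k : Fin n, j ≠ k → D.inner i j ∩ D.inner i k = ∅
  indep : ∀ i j k l : Fin n, ([i, j, k, l] : List (Fin n)).Nodup →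
    (D.inner i j ∩ D.inner k l).Subsingleton
  no_triple : ∀ p : Sph, p ∉ Set.range D.vert →
    {s : Fin n × Fin n | s.1 < s.2 ∧ p ∈ D.arc s.1 s.2}.encard ≤ 2

/-- Independent edges `ij` and `kl` cross: their interiors meet. -/
def Cross (D : SphereDrawing n) (i j k l : Fin n) : Prop :=
  (D.inner i j ∩ D.inner k l).Nonempty

end SphereDrawing

/-- A self-homeomorphism of the sphere is orientation preserving iff it is homotopic to
the identity (i.e. has degree `1`). -/
def OrientPres (h : Sph ≃ₜ Sph) : Prop :=
  ContinuousMap.Homotopic ⟨⇑h, h.continuous⟩ (ContinuousMap.id Sph)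

/-- Two drawings of `K_n` have the same rotation at `v` if some orientation-preserving
homeomorphism of the sphere carries the first drawing's germ at `v` (the vertex together
with initial pieces of all incident edges) into the second drawing's edges at `v`. -/
def SameRotationAt (D1 D2 : SphereDrawing n) (v : Fin n) : Prop :=
  ∃ h : Sph ≃ₜ Sph, OrientPres h ∧ h (D1.vert v) = D2.vert v ∧
    ∃ U ∈ nhds (D1.vert v), ∀ u : Fin n, u ≠ v →
      h '' (D1.arc v u ∩ U) ⊆ D2.arc v u

/-- Same rotation scheme: the same rotation at every vertex. -/
def SameRotation {n : ℕ} (D1 D2 : SphereDrawing n) : Prop :=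
  ∀ v : Fin n, SameRotationAt D1 D2 v

/-- A nonvanishing continuous function on a simply connected space has a continuous logarithm. -/
theorem exists_continuous_exp_eq {X : Type*} [TopologicalSpace X] [SimplyConnectedSpace X]
    [LocallyPathConnectedSpace X] {f : X → ℂ} (hf : Continuous f) (h0 : ∀ x, f x ≠ 0) :
    ∃ g : X → ℂ, Continuous g ∧ ∀ x, Complex.exp (g x) = f x := by
  obtain ⟨x₀⟩ : Nonempty X := inferInstance
  obtain ⟨F, ⟨-, hF⟩, -⟩ := Complex.isCoveringMapOn_exp.existsUnique_continuousMap_lifts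
    ⟨f, hf⟩ (a₀ := x₀) (Complex.exp_log (h0 x₀)) (fun x ↦ h0 x)
  exact ⟨F, F.continuous, fun x ↦ congrFun hF x⟩

theorem exists_continuous_exp_eq_unitInterval {f : I → ℂ} (hf : Continuous f)
    (h0 : ∀ x, f x ≠ 0) : ∃ g : I → ℂ, Continuous g ∧ ∀ x, Complex.exp (g x) = f x := by
  obtain ⟨g, hg, h⟩ := exists_continuous_exp_eq
    (f := fun x : ℝ ↦ f (projIcc 0 1 zero_le_one x)) (hf.comp continuous_projIcc) (fun x ↦ h0 _)
  exact ⟨fun t ↦ g t, hg.comp continuous_subtype_val, fun t ↦ by simp [h]⟩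

theorem IsPreconnected.eq_of_exp_eq {X : Type*} [TopologicalSpace X] {S : Set X}
    (hS : IsPreconnected S) {u : X → ℂ} (hu : ContinuousOn u S) {c : ℂ}
    (h : ∀ x ∈ S, Complex.exp (u x) = c) {x y : X} (hx : x ∈ S) (hy : y ∈ S) : u x = u y :=
  Complex.isCoveringMap_exp.constOn_of_comp hS hu
    (fun a ha b hb ↦ Subtype.ext ((h a ha).trans (h b hb).symm)) hx hy

/-- If two continuous functions have the same exponential on a preconnected set, they differ by
a constant there. -/
theorem IsPreconnected.sub_eq_sub_of_exp_eq {X : Type*} [TopologicalSpace X] {S : Set X}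
    (hS : IsPreconnected S) {u v : X → ℂ} (hu : ContinuousOn u S) (hv : ContinuousOn v S)
    (h : ∀ x ∈ S, Complex.exp (u x) = Complex.exp (v x)) {x y : X} (hx : x ∈ S) (hy : y ∈ S) :
    u x - v x = u y - v y :=
  hS.eq_of_exp_eq (u := fun x ↦ u x - v x) (hu.sub hv) (c := 1)
    (fun x hx ↦ by rw [Complex.exp_sub, h x hx, div_self (Complex.exp_ne_zero _)]) hx hy

theorem eq_zero_of_exp_eq_zpow_on_sphere {g : ℂ → ℂ} {p : ℂ} {R : ℝ} (hR : 0 < R) {m : ℤ}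
    (hg : ContinuousOn g (Metric.sphere p R))
    (h : ∀ z ∈ Metric.sphere p R, Complex.exp (g z) = (z - p) ^ m) : m = 0 := by
  have hmem : ∀ t : ℝ, circleMap p R t ∈ Metric.sphere p R := circleMap_mem_sphere p hR.le
  have hk : ∀ t : ℝ, Complex.exp (g (circleMap p R t)) =
      Complex.exp (m * (Real.log R + t * Complex.I)) := fun t ↦ by
    rw [h _ (hmem t), Complex.exp_int_mul, Complex.exp_add, ← Complex.ofReal_exp,
      Real.exp_log hR]
    simp [circleMap]
  have := isPreconnected_univ.sub_eq_sub_of_exp_eq (X := ℝ)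
    (u := fun t ↦ g (circleMap p R t)) (v := fun t ↦ m * (Real.log R + t * Complex.I))
    (hg.comp (continuous_circleMap p R).continuousOn fun t _ ↦ hmem t) (by fun_prop)
    (fun t _ ↦ hk t) (mem_univ 0) (mem_univ (2 * Real.pi))
  have h2 : circleMap p R (2 * Real.pi) = circleMap p R 0 := by simp [circleMap]
  simp only [h2] at this
  have h3 : (m : ℂ) * (2 * Real.pi * Complex.I) = 0 := by
    push_cast at this
    linear_combination this
  simpa [Complex.two_pi_I_ne_zero] using h3

/-- The increment along `γ` of the logarithm of `z - γ t`: a continuous logarithm of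
`(z - γ 1) / (z - γ 0)` off the path. -/
theorem exists_log_off_path {γ : I → ℂ} (hγ : Continuous γ) :
    ∃ L : ℂ → ℂ, ContinuousOn L (range γ)ᶜ ∧
      ∀ z ∉ range γ, Complex.exp (L z) * (z - γ 0) = z - γ 1 := by
  have hne : ∀ z ∉ range γ, ∀ t, z - γ t ≠ 0 := fun z hz t h ↦ hz ⟨t, (sub_eq_zero.1 h).symm⟩
  have hex : ∀ z, ∃ g : I → ℂ, z ∉ range γ → Continuous g ∧ ∀ t, Complex.exp (g t) = z - γ t := by
    intro z
    by_cases hz : z ∈ range γ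
    · exact ⟨0, fun h ↦ (h hz).elim⟩
    · obtain ⟨g, hg⟩ := exists_continuous_exp_eq_unitInterval (f := fun t ↦ z - γ t)
        (by fun_prop) (hne z hz)
      exact ⟨g, fun _ ↦ hg⟩
  choose ℓ hℓ using hex
  refine ⟨fun z ↦ ℓ z 1 - ℓ z 0, ?_, fun z hz ↦ ?_⟩
  · intro z₀ hz₀
    have hclosed : IsClosed (range γ) := (isCompact_range hγ).isClosed
    obtain ⟨ε, hε, hball⟩ := Metric.isOpen_iff.1 hclosed.isOpen_compl z₀ hz₀
    have hslit : ∀ z ∈ Metric.ball z₀ ε, ∀ t, (z - γ t) / (z₀ - γ t) ∈ Complex.slitPlane := by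
      intro z hz t
      have h1 : ε ≤ ‖z₀ - γ t‖ := by
        by_contra! hlt
        exact hball (by rwa [Metric.mem_ball, dist_comm, dist_eq_norm]) ⟨t, rfl⟩
      have h2 : ‖(z - γ t) / (z₀ - γ t) - 1‖ < 1 := by
        have : (z - γ t) / (z₀ - γ t) - 1 = (z - z₀) / (z₀ - γ t) := by
          have := hne z₀ hz₀ t
          field_simp
          ring
        rw [this, norm_div, div_lt_one (hε.trans_le h1)]
        rw [Metric.mem_ball, dist_eq_norm] at hz
        exact hz.trans_le h1
      have := Complex.mem_slitPlane_of_norm_lt_one h2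
      simpa using this
    have hformula : ∀ z ∈ Metric.ball z₀ ε, ℓ z 1 - ℓ z 0 = ℓ z₀ 1 - ℓ z₀ 0 +
        (Complex.log ((z - γ 1) / (z₀ - γ 1)) - Complex.log ((z - γ 0) / (z₀ - γ 0))) := by
      intro z hz
      have hz' := hball hz
      have hc : Continuous fun t ↦ ℓ z₀ t + Complex.log ((z - γ t) / (z₀ - γ t)) :=
        (hℓ z₀ hz₀).1.add (Continuous.clog (by
          have := hne z₀ hz₀
          fun_prop (disch := assumption)) (hslit z hz))
      have := isPreconnected_univ.sub_eq_sub_of_exp_eq (hℓ z hz').1.continuousOn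
        hc.continuousOn (fun t _ ↦ by
          rw [Complex.exp_add, (hℓ z hz').2, (hℓ z₀ hz₀).2,
            Complex.exp_log (div_ne_zero (hne z hz' t) (hne z₀ hz₀ t)),
            mul_div_cancel₀ _ (hne z₀ hz₀ t)]) (mem_univ 0) (mem_univ 1)
      linear_combination -this
    have hcont : ContinuousAt (fun z ↦ ℓ z₀ 1 - ℓ z₀ 0 +
        (Complex.log ((z - γ 1) / (z₀ - γ 1)) - Complex.log ((z - γ 0) / (z₀ - γ 0)))) z₀ := by
      have h := fun t ↦ hslit z₀ (Metric.mem_ball_self hε) t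
      have hlog : ∀ t, ContinuousAt (fun z ↦ Complex.log ((z - γ t) / (z₀ - γ t))) z₀ :=
        fun t ↦ ContinuousAt.clog (by fun_prop) (h t)
      exact continuousAt_const.add ((hlog 1).sub (hlog 0))
    refine (hcont.congr ?_).continuousWithinAt
    filter_upwards [Metric.ball_mem_nhds z₀ hε] with z hz using (hformula z hz).symm
  · rw [Complex.exp_sub, (hℓ z hz).2, (hℓ z hz).2, div_mul_cancel₀ _ (hne z hz 0)]

theorem exists_continuousOn_union {X Y : Type*} [TopologicalSpace X] [TopologicalSpace Y]
    {A B : Set X} (hA : IsClosed A) (hB : IsClosed B) {u v : X → Y} (hu : ContinuousOn u A)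
    (hv : ContinuousOn v B) (h : ∀ x ∈ A ∩ B, u x = v x) :
    ∃ w : X → Y, ContinuousOn w (A ∪ B) ∧ EqOn w u A ∧ EqOn w v B := by
  classical
  have hwu : EqOn (A.piecewise u v) u A := A.piecewise_eqOn u v
  have hwv : EqOn (A.piecewise u v) v B := fun x hx ↦ by
    by_cases hxA : x ∈ A
    · rw [hwu hxA, h x ⟨hxA, hx⟩]
    · simp [hxA]
  exact ⟨_, (hu.congr hwu).union_of_isClosed (hv.congr hwv) hA hB, hwu, hwv⟩

/-- Every nonvanishing continuous function on `K` has a continuous logarithm on `K`. -/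
def HasLogs (K : Set ℂ) : Prop :=
  ∀ f : ℂ → ℂ, ContinuousOn f K → (∀ z ∈ K, f z ≠ 0) →
    ∃ g : ℂ → ℂ, ContinuousOn g K ∧ ∀ z ∈ K, Complex.exp (g z) = f z

theorem hasLogs_range {γ : I → ℂ} (hγ : Continuous γ) (hinj : Function.Injective γ) :
    HasLogs (range γ) := by
  intro f hf h0
  obtain ⟨g, hg, hgf⟩ := exists_continuous_exp_eq_unitInterval (f := fun t ↦ f (γ t))
    (hf.comp_continuous hγ mem_range_self) (fun t ↦ h0 _ ⟨t, rfl⟩)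
  have hemb := (hγ.isClosedEmbedding hinj)
  obtain ⟨G, hG⟩ := ContinuousMap.exists_extension' hemb ⟨g, hg⟩
  refine ⟨G, G.continuous.continuousOn, ?_⟩
  rintro _ ⟨t, rfl⟩
  rw [← hgf]
  exact congrArg Complex.exp (congrFun hG t)

theorem HasLogs.union {A B : Set ℂ} (hA : IsClosed A) (hB : IsClosed B) (lA : HasLogs A)
    (lB : HasLogs B) {x : ℂ} (hAB : A ∩ B = {x}) : HasLogs (A ∪ B) := by
  intro f hf h0
  obtain ⟨a, ha, haf⟩ := lA f (hf.mono subset_union_left) fun z hz ↦ h0 z (.inl hz)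
  obtain ⟨b, hb, hbf⟩ := lB f (hf.mono subset_union_right) fun z hz ↦ h0 z (.inr hz)
  have hx : x ∈ A ∩ B := hAB ▸ rfl
  obtain ⟨w, hw, hwa, hwb⟩ := exists_continuousOn_union hA hB ha
    (v := fun z ↦ b z + (a x - b x)) (hb.add continuousOn_const) (by
      rw [hAB]
      rintro _ rfl
      ring)
  refine ⟨w, hw, ?_⟩
  rintro z (hz | hz)
  · rw [hwa hz, haf z hz]
  · rw [hwb hz, Complex.exp_add, hbf z hz, Complex.exp_sub, haf x hx.1, hbf x hx.2,
      div_self (h0 x (.inl hx.1)), mul_one]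

/-- Two nonvanishing functions on a union of two arcs with common endpoints `x`, `y`
are multiplicatively dependent modulo exponentials. -/
theorem exists_zpow_eq_exp_mul_zpow {A B : Set ℂ} (hA : IsClosed A) (hB : IsClosed B)
    (lA : HasLogs A) (lB : HasLogs B) {x y : ℂ} (hAB : A ∩ B = {x, y}) {f₁ f₂ : ℂ → ℂ}
    (hf₁ : ContinuousOn f₁ (A ∪ B)) (hf₂ : ContinuousOn f₂ (A ∪ B))
    (h₁ : ∀ z ∈ A ∪ B, f₁ z ≠ 0) (h₂ : ∀ z ∈ A ∪ B, f₂ z ≠ 0) :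
    ∃ m n : ℤ, (m ≠ 0 ∨ n ≠ 0) ∧ ∃ F : ℂ → ℂ, ContinuousOn F (A ∪ B) ∧
      ∀ z ∈ A ∪ B, f₁ z ^ m * f₂ z ^ n = Complex.exp (F z) := by
  have hx : x ∈ A ∩ B := hAB ▸ .inl rfl
  have hy : y ∈ A ∩ B := hAB ▸ .inr rfl
  have key : ∀ f : ℂ → ℂ, ContinuousOn f (A ∪ B) → (∀ z ∈ A ∪ B, f z ≠ 0) →
      ∃ a b : ℂ → ℂ, ∃ d : ℤ, ContinuousOn a A ∧ ContinuousOn b B ∧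
        (∀ z ∈ A, Complex.exp (a z) = f z) ∧ (∀ z ∈ B, Complex.exp (b z) = f z) ∧
        a x = b x ∧ a y = b y + d * (2 * Real.pi * Complex.I) := by
    intro f hf h0
    obtain ⟨a, ha, haf⟩ := lA f (hf.mono subset_union_left) fun z hz ↦ h0 z (.inl hz)
    obtain ⟨b, hb, hbf⟩ := lB f (hf.mono subset_union_right) fun z hz ↦ h0 z (.inr hz)
    obtain ⟨k, hk⟩ := Complex.exp_eq_exp_iff_exists_int.1 ((haf x hx.1).trans (hbf x hx.2).symm)
    obtain ⟨l, hl⟩ := Complex.exp_eq_exp_iff_exists_int.1 ((haf y hy.1).trans (hbf y hy.2).symm)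
    refine ⟨a, fun z ↦ b z + k * (2 * Real.pi * Complex.I), l - k, ha,
      hb.add continuousOn_const, haf, fun z hz ↦ ?_, hk, ?_⟩
    · rw [Complex.exp_add, Complex.exp_int_mul_two_pi_mul_I, mul_one, hbf z hz]
    · rw [hl]
      push_cast
      ring
  obtain ⟨a₁, b₁, d₁, ha₁, hb₁, haf₁, hbf₁, hx₁, hy₁⟩ := key f₁ hf₁ h₁
  obtain ⟨a₂, b₂, d₂, ha₂, hb₂, haf₂, hbf₂, hx₂, hy₂⟩ := key f₂ hf₂ h₂
  obtain ⟨m, n, hmn, hd⟩ : ∃ m n : ℤ, (m ≠ 0 ∨ n ≠ 0) ∧ m * d₁ + n * d₂ = 0 := by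
    by_cases h : d₁ = 0
    · exact ⟨1, 0, by simp, by simp [h]⟩
    · exact ⟨d₂, -d₁, .inr (by simpa using h), by ring⟩
  refine ⟨m, n, hmn, ?_⟩
  obtain ⟨w, hw, hwa, hwb⟩ := exists_continuousOn_union hA hB
    (u := fun z ↦ m * a₁ z + n * a₂ z) (v := fun z ↦ m * b₁ z + n * b₂ z)
    (by fun_prop) (by fun_prop) (by
      rw [hAB]
      rintro _ (rfl | rfl)
      · rw [hx₁, hx₂]
      · have hd' : (m : ℂ) * d₁ + n * d₂ = 0 := mod_cast hd
        rw [hy₁, hy₂]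
        linear_combination (2 * Real.pi * Complex.I) * hd')
  refine ⟨w, hw, ?_⟩
  rintro z (hz | hz)
  · rw [hwa hz, Complex.exp_add, Complex.exp_int_mul, Complex.exp_int_mul, haf₁ z hz, haf₂ z hz]
  · rw [hwb hz, Complex.exp_add, Complex.exp_int_mul, Complex.exp_int_mul, hbf₁ z hz, hbf₂ z hz]

theorem not_isPreconnected_compl_union {A B : Set ℂ} (hA : IsClosed A) (hB : IsClosed B)
    {P Q : ℂ} (hPQ : P ≠ Q) (hAB : A ∩ B = {P, Q}) {u v : ℂ → ℂ} (hu : ContinuousOn u Aᶜ)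
    (hv : ContinuousOn v Bᶜ) (hu' : ∀ z ∉ A, Complex.exp (u z) * (z - P) = z - Q)
    (hv' : ∀ z ∉ B, Complex.exp (v z) * (z - P) = z - Q) : ¬ IsPreconnected (A ∪ B)ᶜ := by
  classical
  intro hpre
  have hP : P ∈ A ∩ B := hAB ▸ .inl rfl
  have hne : ∀ {z}, z ∉ A ∩ B → z - P ≠ 0 := fun hz h ↦ hz (sub_eq_zero.1 h ▸ hP)
  obtain ⟨c, hc1, hc⟩ : ∃ c : ℂ, Complex.exp c = 1 ∧ ∀ z ∉ A ∪ B, u z = v z + c := by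
    have hexp : ∀ z ∈ (A ∪ B)ᶜ, Complex.exp (u z) = Complex.exp (v z) := fun z hz ↦ by
      have h := hne (z := z) fun h ↦ hz (.inl h.1)
      exact mul_right_cancel₀ h
        ((hu' z fun h ↦ hz (.inl h)).trans (hv' z fun h ↦ hz (.inr h)).symm)
    rcases ((A ∪ B)ᶜ).eq_empty_or_nonempty with he | ⟨z₀, hz₀⟩
    · exact ⟨0, by simp, fun z hz ↦ (he ▸ hz : z ∈ (∅ : Set ℂ)).elim⟩
    · refine ⟨u z₀ - v z₀, ?_, fun z hz ↦ ?_⟩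
      · rw [Complex.exp_sub, hexp z₀ hz₀, div_self (Complex.exp_ne_zero _)]
      · have := hpre.sub_eq_sub_of_exp_eq
          (hu.mono (compl_subset_compl.2 subset_union_left))
          (hv.mono (compl_subset_compl.2 subset_union_right)) hexp hz hz₀
        linear_combination this
  set w : ℂ → ℂ := Aᶜ.piecewise u (fun z ↦ v z + c)
  have hwu : EqOn w u Aᶜ := Aᶜ.piecewise_eqOn _ _
  have hwv : EqOn w (fun z ↦ v z + c) Bᶜ := fun z hz ↦ by
    by_cases hzA : z ∈ Aᶜ
    · rw [hwu hzA, hc z (by rintro (h | h) <;> contradiction)]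
    · simp [w, notMem_compl_iff.1 hzA]
  have hw : ContinuousOn w (Aᶜ ∪ Bᶜ) :=
    (hu.congr hwu).union_of_isOpen ((hv.add continuousOn_const).congr hwv)
      hA.isOpen_compl hB.isOpen_compl
  have hw' : ∀ z ∈ Aᶜ ∪ Bᶜ, Complex.exp (w z) * (z - P) = z - Q := by
    rintro z (hz | hz)
    · rw [hwu hz, hu' z hz]
    · rw [hwv hz, Complex.exp_add, hc1, mul_one, hv' z hz]
  have hPQ' : P - Q ≠ 0 := sub_ne_zero.2 hPQ
  have hr : 0 < ‖P - Q‖ / 2 := by positivity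
  have hsub : Metric.sphere P (‖P - Q‖ / 2) ⊆ Aᶜ ∪ Bᶜ := by
    rw [← compl_inter, hAB]
    rintro z hz (rfl | rfl)
    · rw [Metric.mem_sphere, dist_self] at hz
      exact hr.ne hz
    · rw [Metric.mem_sphere, dist_comm, dist_eq_norm] at hz
      linarith
  have hslit : ∀ z ∈ Metric.sphere P (‖P - Q‖ / 2), (z - Q) / (P - Q) ∈ Complex.slitPlane := by
    intro z hz
    rw [Metric.mem_sphere, dist_eq_norm] at hz
    have : (z - Q) / (P - Q) = 1 + (z - P) / (P - Q) := by
      field_simp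
      ring
    rw [this]
    apply Complex.mem_slitPlane_of_norm_lt_one
    rw [norm_div, hz, div_lt_one (by positivity)]
    linarith
  refine one_ne_zero (eq_zero_of_exp_eq_zpow_on_sphere hr (m := 1) (p := P)
    (g := fun z ↦ Complex.log ((z - Q) / (P - Q)) + Complex.log (P - Q) - w z) ?_ fun z hz ↦ ?_)
  · exact ((ContinuousOn.clog (by fun_prop) hslit).add continuousOn_const).sub (hw.mono hsub)
  · have hz0 : (z - Q) / (P - Q) ≠ 0 := Complex.slitPlane_ne_zero (hslit z hz)
    rw [Complex.exp_sub, Complex.exp_add, Complex.exp_log hz0, Complex.exp_log hPQ',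
      div_mul_cancel₀ _ hPQ', ← hw' z (hsub hz), mul_div_cancel_left₀ _ (Complex.exp_ne_zero _),
      zpow_one]

theorem frontier_connectedComponentIn_compl_subset {X : Type*} [TopologicalSpace X]
    [LocallyConnectedSpace X] {K : Set X} (hK : IsClosed K) (p : X) :
    frontier (connectedComponentIn Kᶜ p) ⊆ K := by
  intro x hx
  by_contra hxK
  rw [hK.isOpen_compl.connectedComponentIn.frontier_eq] at hx
  obtain ⟨y, hyx, hyp⟩ := mem_closure_iff.1 hx.1 _ hK.isOpen_compl.connectedComponentIn
    (mem_connectedComponentIn hxK)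
  apply hx.2
  rw [connectedComponentIn_eq hyp, ← connectedComponentIn_eq hyx]
  exact mem_connectedComponentIn hxK

/-- If `p` lies in a bounded component of `Kᶜ` and `q` does not lie in that component, then
`(z - p) ^ m * (z - q) ^ n` has a continuous logarithm on `K` only for `m = 0`. -/
theorem eq_zero_of_zpow_mul_zpow_eq_exp {K : Set ℂ} (hK : IsClosed K) {p q : ℂ} (hp : p ∉ K)
    (hq : q ∉ K) (hb : Bornology.IsBounded (connectedComponentIn Kᶜ p))
    (hqU : q ∉ connectedComponentIn Kᶜ p) {m n : ℤ} {F : ℂ → ℂ} (hF : ContinuousOn F K)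
    (h : ∀ z ∈ K, (z - p) ^ m * (z - q) ^ n = Complex.exp (F z)) : m = 0 := by
  classical
  set U := connectedComponentIn Kᶜ p
  have hfr : frontier U ⊆ K := frontier_connectedComponentIn_compl_subset hK p
  have hpU : p ∈ U := mem_connectedComponentIn hp
  have hUo : IsOpen U := hK.isOpen_compl.connectedComponentIn
  have hqc : q ∉ closure U := fun h ↦ by
    rw [closure_eq_self_union_frontier] at h
    exact h.elim hqU fun h ↦ hq (hfr h)
  obtain ⟨G, hG⟩ := ContinuousMap.exists_restrict_eq hK
    ⟨fun x : K ↦ F x, hF.comp_continuous continuous_subtype_val fun x ↦ x.2⟩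
  have hGF : ∀ z ∈ K, G z = F z := fun z hz ↦ DFunLike.congr_fun hG ⟨z, hz⟩
  let k : ℂ → ℂ := fun z ↦ if z ∈ U then Complex.exp (G z) * (z - q) ^ (-n) else (z - p) ^ m
  have hpne : ∀ z ∉ U, z - p ≠ 0 := fun z hz h ↦ hz (sub_eq_zero.1 h ▸ hpU)
  have hqne : ∀ z ∈ closure U, z - q ≠ 0 := fun z hz h ↦ hqc (sub_eq_zero.1 h ▸ hz)
  have hk : Continuous k := by
    rw [← continuousOn_univ]
    refine ContinuousOn.if (fun z hz ↦ ?_) ?_ ?_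
    · have hzK := hfr hz.2
      have hz0 := hqne z (frontier_subset_closure hz.2)
      rw [hGF z hzK, ← h z hzK, mul_assoc, ← zpow_add₀ hz0, add_neg_cancel, zpow_zero, mul_one]
    · refine (Complex.continuous_exp.comp G.continuous).continuousOn.mul
        (ContinuousOn.zpow₀ (by fun_prop) _ fun z hz ↦ .inl (hqne z hz.2))
    · refine ContinuousOn.zpow₀ (by fun_prop) _ fun z hz ↦ .inl (hpne z ?_)
      have : z ∈ closure Uᶜ := hz.2
      rwa [hUo.isClosed_compl.closure_eq] at this
  have hk0 : ∀ z, k z ≠ 0 := fun z ↦ by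
    by_cases hz : z ∈ U
    · simpa [k, hz] using fun h0 ↦ (zpow_ne_zero n (hqne z (subset_closure hz)) h0).elim
    · simpa [k, hz] using zpow_ne_zero m (hpne z hz)
  obtain ⟨g, hg, hgk⟩ := exists_continuous_exp_eq hk hk0
  obtain ⟨R, hR⟩ := hb.subset_ball p
  have hR0 : 0 < R := Metric.pos_of_mem_ball (hR hpU)
  refine eq_zero_of_exp_eq_zpow_on_sphere (p := p) hR0 hg.continuousOn fun z hz ↦ ?_
  have hzU : z ∉ U := fun h ↦ (Metric.mem_ball.1 (hR h)).ne hz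
  rw [hgk]
  simp [k, hzU]

theorem isPreconnected_compl_closedBall_complex (R : ℝ) (hR : 0 ≤ R) :
    IsPreconnected (Metric.closedBall (0 : ℂ) R)ᶜ := by
  have h : (Metric.closedBall (0 : ℂ) R)ᶜ =
      (fun x : ℝ × ℝ ↦ (x.1 : ℂ) * Complex.exp (x.2 * Complex.I)) '' (Ioi R ×ˢ univ) := by
    ext z
    simp only [mem_compl_iff, Metric.mem_closedBall, dist_zero_right, not_le, mem_image, mem_prod,
      mem_Ioi, mem_univ, and_true, Prod.exists]
    constructor
    · exact fun hz ↦ ⟨‖z‖, z.arg, hz, Complex.norm_mul_exp_arg_mul_I z⟩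
    · rintro ⟨r, t, hr, rfl⟩
      simpa [Complex.norm_exp_ofReal_mul_I, abs_of_pos (hR.trans_lt hr)] using hr
  rw [h]
  exact (isPreconnected_Ioi.prod isPreconnected_univ).image _ (by fun_prop)

/-- The Jordan curve theorem in the plane: a closed curve made of two arcs separates the plane
into a bounded and an unbounded connected open set. -/
theorem exists_bounded_component_of_two_arcs {A B : Set ℂ} (hA : IsCompact A) (hB : IsCompact B)
    (lA : HasLogs A) (lB : HasLogs B) {P Q : ℂ} (hAB : A ∩ B = {P, Q})
    (hpre : ¬ IsPreconnected (A ∪ B)ᶜ) :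
    ∃ U : Set ℂ, IsOpen U ∧ IsConnected U ∧ Bornology.IsBounded U ∧ Disjoint U (A ∪ B) ∧
      IsOpen (U ∪ (A ∪ B))ᶜ ∧ IsPreconnected (U ∪ (A ∪ B))ᶜ := by
  set K := A ∪ B
  have hKc : IsCompact K := hA.union hB
  have hK : IsClosed K := hKc.isClosed
  obtain ⟨R, hR⟩ := hKc.isBounded.subset_closedBall 0
  obtain ⟨w, hw⟩ : ∃ w : ℂ, w ∈ (Metric.closedBall (0 : ℂ) |R|)ᶜ := by
    refine ⟨((|R| + 1 : ℝ) : ℂ), ?_⟩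
    rw [mem_compl_iff, mem_closedBall_zero_iff, Complex.norm_real, Real.norm_eq_abs, not_le]
    exact (lt_add_one _).trans_le (le_abs_self _)
  have hKball : K ⊆ Metric.closedBall 0 |R| :=
    hR.trans (Metric.closedBall_subset_closedBall (le_abs_self R))
  set V := connectedComponentIn Kᶜ w with hV
  have hballV : (Metric.closedBall (0 : ℂ) |R|)ᶜ ⊆ V :=
    (isPreconnected_compl_closedBall_complex _ (abs_nonneg R)).subset_connectedComponentIn hw
      (compl_subset_compl.2 hKball)
  have hbdd : ∀ p ∉ V, Bornology.IsBounded (connectedComponentIn Kᶜ p) := by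
    refine fun p hp ↦
      (Metric.isBounded_closedBall (x := (0 : ℂ)) (r := |R|)).subset fun z hz ↦ ?_
    by_contra hzb
    have hzV := hballV hzb
    apply hp
    rw [hV, connectedComponentIn_eq hzV, ← connectedComponentIn_eq hz]
    exact mem_connectedComponentIn (connectedComponentIn_nonempty_iff.1 ⟨z, hz⟩)
  obtain ⟨p, hpK, hpV⟩ : ∃ p ∉ K, p ∉ V := by
    by_contra! h
    have : Kᶜ = V := Subset.antisymm h (connectedComponentIn_subset _ _)
    exact hpre (this ▸ isPreconnected_connectedComponentIn)
  set U := connectedComponentIn Kᶜ p with hU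
  have hUK : Disjoint U K := disjoint_left.2 fun z hz ↦ connectedComponentIn_subset _ _ hz
  have hcompl : (U ∪ K)ᶜ = V := by
    refine Subset.antisymm (fun q hq ↦ ?_) fun z hz ↦ ?_
    · by_contra hqV
      have hqU : q ∉ U := fun h ↦ hq (.inl h)
      have hqK : q ∉ K := fun h ↦ hq (.inr h)
      have hpq : p ∉ connectedComponentIn Kᶜ q := fun h ↦ hqU <| by
        rw [hU, ← connectedComponentIn_eq h]
        exact mem_connectedComponentIn hqK
      obtain ⟨m, n, hmn, F, hF, hexp⟩ := exists_zpow_eq_exp_mul_zpow hA.isClosed hB.isClosed lA lB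
        hAB (f₁ := fun z ↦ z - p) (f₂ := fun z ↦ z - q) (by fun_prop) (by fun_prop)
        (fun z hz h ↦ hpK (sub_eq_zero.1 h ▸ hz)) (fun z hz h ↦ hqK (sub_eq_zero.1 h ▸ hz))
      rcases hmn with hm | hn
      · exact hm (eq_zero_of_zpow_mul_zpow_eq_exp hK hpK hqK (hbdd p hpV) hqU hF hexp)
      · exact hn (eq_zero_of_zpow_mul_zpow_eq_exp hK hqK hpK (hbdd q hqV) hpq hF
          fun z hz ↦ by rw [mul_comm, hexp z hz])
    · rintro (h | h)
      · apply hpV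
        rw [hV, connectedComponentIn_eq hz, ← connectedComponentIn_eq h]
        exact mem_connectedComponentIn hpK
      · exact connectedComponentIn_subset _ _ hz h
  refine ⟨U, hK.isOpen_compl.connectedComponentIn, isConnected_connectedComponentIn_iff.2 hpK,
    hbdd p hpV, hUK, ?_, ?_⟩
  · exact hcompl ▸ hK.isOpen_compl.connectedComponentIn
  · exact hcompl ▸ isPreconnected_connectedComponentIn

/-- The Jordan curve theorem in the plane for a closed curve made of three arcs. -/
theorem exists_bounded_component_of_three_arcs {α β γ : I → ℂ} (hα : Continuous α)
    (hβ : Continuous β) (hγ : Continuous γ) (iα : Function.Injective α)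
    (iβ : Function.Injective β) (iγ : Function.Injective γ) (h₀ : β 0 = α 0) (h₁ : γ 1 = α 1)
    (hβγ : γ 0 = β 1) (hαβ' : range α ∩ range β ⊆ {α 0}) (hαγ' : range α ∩ range γ ⊆ {α 1})
    (hβγ' : range β ∩ range γ ⊆ {β 1}) :
    ∃ U : Set ℂ, IsOpen U ∧ IsConnected U ∧ Bornology.IsBounded U ∧
      Disjoint U (range α ∪ (range β ∪ range γ)) ∧
      IsOpen (U ∪ (range α ∪ (range β ∪ range γ)))ᶜ ∧
      IsPreconnected (U ∪ (range α ∪ (range β ∪ range γ)))ᶜ := by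
  have cα := isCompact_range hα
  have cβ := isCompact_range hβ
  have cγ := isCompact_range hγ
  have hint : range α ∩ (range β ∪ range γ) = {α 0, α 1} := by
    refine Subset.antisymm ?_ ?_
    · rintro z ⟨hz, h | h⟩
      · exact .inl (hαβ' ⟨hz, h⟩)
      · exact .inr (hαγ' ⟨hz, h⟩)
    · rintro z (rfl | rfl)
      · exact ⟨⟨0, rfl⟩, .inl ⟨0, h₀⟩⟩
      · exact ⟨⟨1, rfl⟩, .inr ⟨1, h₁⟩⟩
  have hint' : range β ∩ range γ = {β 1} :=
    Subset.antisymm hβγ' (singleton_subset_iff.2 ⟨⟨1, rfl⟩, ⟨0, hβγ⟩⟩)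
  refine exists_bounded_component_of_two_arcs cα (cβ.union cγ) (hasLogs_range hα iα)
    ((hasLogs_range hβ iβ).union cβ.isClosed cγ.isClosed (hasLogs_range hγ iγ) hint') hint ?_
  obtain ⟨u, hu, hu'⟩ := exists_log_off_path hα
  obtain ⟨v, hv, hv'⟩ := exists_log_off_path hβ
  obtain ⟨w, hw, hw'⟩ := exists_log_off_path hγ
  refine not_isPreconnected_compl_union cα.isClosed (cβ.union cγ).isClosed
    (iα.ne zero_ne_one) hint hu (v := fun z ↦ w z + v z) ?_ hu' fun z hz ↦ ?_
  · exact (hw.mono (compl_subset_compl.2 subset_union_right)).add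
      (hv.mono (compl_subset_compl.2 subset_union_left))
  · rw [Complex.exp_add, mul_assoc, ← h₀, hv' z fun h ↦ hz (.inl h), ← hβγ,
      hw' z fun h ↦ hz (.inr h), h₁]

theorem exists_openPartialHomeomorph_sphere (v : Sph) :
    ∃ e : OpenPartialHomeomorph Sph ℂ, e.source = {v}ᶜ ∧ e.target = univ := by
  have : Fact (Module.finrank ℝ (EuclideanSpace ℝ (Fin 3)) = 2 + 1) := ⟨by simp⟩
  refine ⟨(stereographic' 2 v).transHomeomorph
    Complex.orthonormalBasisOneI.repr.symm.toHomeomorph, ?_, ?_⟩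
  · simp
  · simp

/-- The Jordan curve theorem in the sphere for a closed curve made of three arcs. -/
theorem exists_two_regions_of_three_arcs {α β γ : I → Sph} (hα : Continuous α)
    (hβ : Continuous β) (hγ : Continuous γ) (iα : Function.Injective α)
    (iβ : Function.Injective β) (iγ : Function.Injective γ) (h₀ : β 0 = α 0) (h₁ : γ 1 = α 1)
    (hβγ : γ 0 = β 1) (hαβ' : range α ∩ range β ⊆ {α 0}) (hαγ' : range α ∩ range γ ⊆ {α 1})
    (hβγ' : range β ∩ range γ ⊆ {β 1}) {C : Set Sph} (hC : C = range α ∪ (range β ∪ range γ))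
    {v : Sph} (hv : v ∉ C) :
    ∃ U V : Set Sph, IsOpen U ∧ IsOpen V ∧ IsConnected U ∧ IsConnected V ∧ Disjoint U V ∧
      U ∪ V = Cᶜ := by
  obtain ⟨e, hs, ht⟩ := exists_openPartialHomeomorph_sphere v
  have hsrc : ∀ {z}, z ≠ v → z ∈ e.source := fun h ↦ hs ▸ h
  have hleft : ∀ {z}, z ≠ v → e.symm (e z) = z := fun h ↦ e.left_inv (hsrc h)
  have hright : ∀ z, e (e.symm z) = z := fun z ↦ e.right_inv (ht ▸ mem_univ z)
  have hsymm : Continuous e.symm := continuousOn_univ.1 (ht ▸ e.continuousOn_symm)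
  have hsv : ∀ z, e.symm z ≠ v := fun z ↦ by
    have := e.map_target (x := z) (ht ▸ mem_univ z)
    rwa [hs] at this
  have nα : ∀ t, α t ≠ v := fun t h ↦ hv (hC ▸ .inl ⟨t, h⟩)
  have nβ : ∀ t, β t ≠ v := fun t h ↦ hv (hC ▸ .inr (.inl ⟨t, h⟩))
  have nγ : ∀ t, γ t ≠ v := fun t h ↦ hv (hC ▸ .inr (.inr ⟨t, h⟩))
  have hcont : ∀ {δ : I → Sph}, Continuous δ → (∀ t, δ t ≠ v) → Continuous (e ∘ δ) :=
    fun h n ↦ e.continuousOn.comp_continuous h fun t ↦ hsrc (n t)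
  have hinj : ∀ {δ : I → Sph}, Function.Injective δ → (∀ t, δ t ≠ v) →
      Function.Injective (e ∘ δ) :=
    fun h n s t hst ↦ h (e.injOn (hsrc (n s)) (hsrc (n t)) hst)
  have hinter : ∀ {δ ε : I → Sph} {x : Sph}, (∀ t, δ t ≠ v) → (∀ t, ε t ≠ v) →
      range δ ∩ range ε ⊆ {x} → range (e ∘ δ) ∩ range (e ∘ ε) ⊆ {e x} := by
    rintro δ ε x nδ nε h _ ⟨⟨s, rfl⟩, ⟨t, ht⟩⟩
    have heq : ε t = δ s := e.injOn (hsrc (nε t)) (hsrc (nδ s)) ht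
    exact congrArg e (h ⟨⟨s, rfl⟩, ⟨t, heq⟩⟩)
  obtain ⟨U, hUo, hUc, hUb, hUK, hVo, hVc⟩ := exists_bounded_component_of_three_arcs
    (hcont hα nα) (hcont hβ nβ) (hcont hγ nγ) (hinj iα nα) (hinj iβ nβ) (hinj iγ nγ)
    (congrArg e h₀) (congrArg e h₁) (congrArg e hβγ) (hinter nα nβ hαβ') (hinter nα nγ hαγ')
    (hinter nβ nγ hβγ')
  set K := range (e ∘ α) ∪ (range (e ∘ β) ∪ range (e ∘ γ))
  have hKC : K = e '' C := by simp only [K, hC, range_comp, image_union]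
  have hsymmK : e.symm '' K = C := by
    rw [hKC, image_image]
    refine (image_congr fun z hz ↦ ?_).trans (image_id' C)
    exact hleft fun h ↦ hv (h ▸ hz)
  have hsinj : Function.Injective e.symm := Function.LeftInverse.injective hright
  have hUKc : IsCompact (U ∪ K) := by
    refine Metric.isCompact_of_isClosed_isBounded (isOpen_compl_iff.1 hVo) (hUb.union ?_)
    exact ((isCompact_range (hcont hα nα)).union ((isCompact_range (hcont hβ nβ)).union
      (isCompact_range (hcont hγ nγ)))).isBounded
  have hcompl : (e.symm '' (U ∪ K))ᶜ = insert v (e.symm '' (U ∪ K)ᶜ) := by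
    ext z
    by_cases hz : z = v
    · subst hz
      simp [hsv]
    · have : ∀ S : Set ℂ, z ∈ e.symm '' S ↔ e z ∈ S := fun S ↦
        ⟨by rintro ⟨x, hx, rfl⟩; rwa [hright], fun h ↦ ⟨e z, h, hleft hz⟩⟩
      rw [mem_compl_iff, this, mem_insert_iff, this, or_iff_right hz, mem_compl_iff]
  have hopen : IsOpen (e.symm '' U) := e.symm.isOpen_image_of_subset_source hUo (by simp [ht])
  have hVopen : IsOpen (e.symm '' (U ∪ K))ᶜ := (hUKc.image hsymm).isClosed.isOpen_compl
  refine ⟨e.symm '' U, (e.symm '' (U ∪ K))ᶜ, hopen, hVopen, hUc.image _ hsymm.continuousOn,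
    ⟨⟨v, hcompl ▸ mem_insert _ _⟩, ?_⟩, ?_, ?_⟩
  · rw [hcompl]
    refine (hVc.image _ hsymm.continuousOn).subset_closure (subset_insert _ _)
      (insert_subset ?_ subset_closure)
    rw [mem_closure_iff]
    intro o ho hvo
    by_contra hne
    have hsingle : (e.symm '' (U ∪ K))ᶜ ∩ o = {v} := by
      refine Subset.antisymm (fun z hz ↦ ?_) (singleton_subset_iff.2 ⟨?_, hvo⟩)
      · have hz' : z ∈ insert v (e.symm '' (U ∪ K)ᶜ) := hcompl ▸ hz.1
        exact hz'.resolve_right fun h ↦ hne ⟨z, hz.2, h⟩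
      · exact hcompl ▸ mem_insert _ _
    have : PreconnectedSpace Sph := Subtype.preconnectedSpace <|
      isPreconnected_sphere (Module.lt_rank_of_lt_finrank (by simp)) _ _
    have huniv : ({v} : Set Sph) = univ :=
      IsClopen.eq_univ ⟨isClosed_singleton, hsingle ▸ hVopen.inter ho⟩ ⟨v, rfl⟩
    exact hsv 0 (huniv ▸ mem_univ _ : e.symm 0 ∈ ({v} : Set Sph))
  · exact disjoint_left.2 fun z hz hz' ↦ hz' (image_mono subset_union_left hz)
  · rw [image_union, hsymmK, compl_union, union_inter_distrib_left, union_compl_self, univ_inter,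
      union_eq_right, ← hsymmK]
    rintro _ ⟨x, hx, rfl⟩ ⟨y, hy, hxy⟩
    exact disjoint_left.1 hUK hx (hsinj hxy ▸ hy)

theorem connectedComponentIn_union_eq_left {X : Type*} [TopologicalSpace X] {U V : Set X}
    (hU : IsOpen U) (hV : IsOpen V) (hUc : IsConnected U) (hUV : Disjoint U V) {x : X}
    (hx : x ∈ U) : connectedComponentIn (U ∪ V) x = U := by
  refine Subset.antisymm ?_ (hUc.isPreconnected.subset_connectedComponentIn hx subset_union_left)
  exact isPreconnected_connectedComponentIn.subset_left_of_subset_union hU hV hUV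
    (connectedComponentIn_subset _ _) ⟨x, mem_connectedComponentIn (.inl hx), hx⟩

theorem subpath_injective {X : Type*} [TopologicalSpace X] {a b : X} {γ : Path a b}
    (hγ : Function.Injective γ) {s t : I} (hst : s ≠ t) : Function.Injective (γ.subpath s t) := by
  intro x y hxy
  have h : (Icc.convexComb s t x : ℝ) = Icc.convexComb s t y := congrArg Subtype.val (hγ hxy)
  simp only [Icc.coe_convexComb] at h
  have hst' : (t : ℝ) - s ≠ 0 := sub_ne_zero.2 fun h ↦ hst (Subtype.ext h.symm)
  exact Subtype.ext (mul_right_cancel₀ hst' (by linear_combination h))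

namespace SphereDrawing

variable {n : ℕ} {D : SphereDrawing n}

theorem arc_eq_range {i j : Fin n} (h : i ≠ j) : D.arc i j = range (D.edge i j h) := by
  simp [arc, h]

theorem arc_comm (i j : Fin n) : D.arc i j = D.arc j i := by
  by_cases h : i = j
  · rw [h]
  · rw [arc_eq_range h, arc_eq_range (Ne.symm h), D.edge_symm i j h, Path.symm_range]

theorem eq_or_eq_of_vert_mem_arc {i j k : Fin n} (h : D.vert k ∈ D.arc i j) :
    k = i ∨ k = j := by
  by_cases hij : i = j
  · simp [arc, hij] at h
  · rw [arc_eq_range hij] at h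
    have : D.vert k ∈ ({D.vert i, D.vert j} : Set Sph) := D.edge_vert i j hij ▸ ⟨h, ⟨k, rfl⟩⟩
    exact this.imp (fun h ↦ D.vert_inj h) fun h ↦ D.vert_inj h

theorem arc_inter_arc_subset {i j k l : Fin n} (hnd : ([i, j, k, l] : List (Fin n)).Nodup) :
    D.arc i j ∩ D.arc k l ⊆ D.inner i j ∩ D.inner k l := by
  rintro z ⟨h, h'⟩
  have hz : z ∉ range D.vert := by
    rintro ⟨m, rfl⟩
    have h₁ := eq_or_eq_of_vert_mem_arc h
    have h₂ := eq_or_eq_of_vert_mem_arc h'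
    simp only [List.nodup_cons, List.mem_cons, List.not_mem_nil] at hnd
    grind
  exact ⟨⟨h, hz⟩, h', hz⟩

/-- In a good drawing, two arcs without common vertices meet in at most one point. -/
theorem IsGood.arc_inter_arc_subset_singleton (hD : D.IsGood) {i j k l : Fin n}
    (hnd : ([i, j, k, l] : List (Fin n)).Nodup) {p : Sph} (hp : p ∈ D.inner i j ∩ D.inner k l) :
    D.arc i j ∩ D.arc k l ⊆ {p} :=
  fun _ hz ↦ hD.indep i j k l hnd (arc_inter_arc_subset hnd hz) hp

theorem IsGood.notMem_inner_of_mem_inner (hD : D.IsGood) {a₁ a₂ b₁ b₂ c₁ c₂ : Fin n}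
    (hnd : ([a₁, a₂, b₁, b₂, c₁, c₂] : List (Fin n)).Nodup) {p : Sph}
    (h₁ : p ∈ D.inner a₁ a₂) (h₂ : p ∈ D.inner b₁ b₂) : p ∉ D.inner c₁ c₂ := by
  intro h₃
  have hord : ∀ i j : Fin n, i ≠ j → p ∈ D.arc i j →
      (min i j, max i j) ∈ {s : Fin n × Fin n | s.1 < s.2 ∧ p ∈ D.arc s.1 s.2} := by
    intro i j hij hp
    rcases hij.lt_or_gt with h | h
    · simpa [min_eq_left h.le, max_eq_right h.le, h] using hp
    · simpa [min_eq_right h.le, max_eq_left h.le, h] using arc_comm i j ▸ hp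
  simp only [List.nodup_cons, List.mem_cons, List.not_mem_nil, or_false, not_or] at hnd
  have hsub : ({(min a₁ a₂, max a₁ a₂), (min b₁ b₂, max b₁ b₂), (min c₁ c₂, max c₁ c₂)} :
      Set (Fin n × Fin n)) ⊆ {s : Fin n × Fin n | s.1 < s.2 ∧ p ∈ D.arc s.1 s.2} := by
    rintro _ (rfl | rfl | rfl)
    · exact hord _ _ (by grind) h₁.1
    · exact hord _ _ (by grind) h₂.1
    · exact hord _ _ (by grind) h₃.1
  have hcard := (encard_le_encard hsub).trans (hD.no_triple p h₁.2)
  rw [encard_insert_of_notMem, encard_pair] at hcard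
  · norm_num at hcard
  · simp only [ne_eq, Prod.mk.injEq, not_and]
    grind
  · simp only [mem_insert_iff, mem_singleton_iff, Prod.mk.injEq, not_or, not_and]
    grind

theorem vert_notMem_image_uIcc {i j : Fin n} (h : i ≠ j) {s t : I}
    (hs : D.edge i j h s ∈ D.inner i j) (ht : D.edge i j h t ∈ D.inner i j) :
    D.vert i ∉ D.edge i j h '' uIcc s t := by
  rintro ⟨r, hr, hri⟩
  have hr0 : r = 0 := D.edge_inj i j h (hri.trans (D.edge i j h).source.symm)
  have hmin : min s t = 0 := le_antisymm (hr0 ▸ hr.1) bot_le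
  have hpos : ∀ u : I, D.edge i j h u ∈ D.inner i j → u ≠ 0 := by
    rintro _ hu rfl
    exact hu.2 ⟨i, (D.edge i j h).source.symm⟩
  rcases min_choice s t with h' | h' <;> rw [h'] at hmin
  · exact hpos s hs hmin
  · exact hpos t ht hmin

end SphereDrawing

/-- In a good drawing of `K_n`, if three pairwise independent edges
`e = a₁a₂`, `f = b₁b₂`, `g = c₁c₂` pairwise cross, then the simple closed curve formed by
the three segments between the crossing points bounds exactly two regions, and at most
one of these regions contains no endpoint of `e`, `f`, `g`. -/
theorem triangle_curve_two_sides {n : ℕ}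
    (D : SphereDrawing n) (hD : D.IsGood)
    (a₁ a₂ b₁ b₂ c₁ c₂ : Fin n)
    (hnd : ([a₁, a₂, b₁, b₂, c₁, c₂] : List (Fin n)).Nodup)
    (ha : a₁ ≠ a₂) (hb : b₁ ≠ b₂) (hc : c₁ ≠ c₂)
    (tef teg ufe ufg vge vgf : unitInterval)
    (hef : (D.edge a₁ a₂ ha) tef = (D.edge b₁ b₂ hb) ufe)
    (heg : (D.edge a₁ a₂ ha) teg = (D.edge c₁ c₂ hc) vge)
    (hfg : (D.edge b₁ b₂ hb) ufg = (D.edge c₁ c₂ hc) vgf)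
    (hef' : (D.edge a₁ a₂ ha) tef ∈ D.inner a₁ a₂ ∩ D.inner b₁ b₂)
    (heg' : (D.edge a₁ a₂ ha) teg ∈ D.inner a₁ a₂ ∩ D.inner c₁ c₂)
    (hfg' : (D.edge b₁ b₂ hb) ufg ∈ D.inner b₁ b₂ ∩ D.inner c₁ c₂)
    (C : Set Sph)
    (hC : C = ⇑(D.edge a₁ a₂ ha) '' Set.uIcc tef teg ∪
        ⇑(D.edge b₁ b₂ hb) '' Set.uIcc ufe ufg ∪
        ⇑(D.edge c₁ c₂ hc) '' Set.uIcc vge vgf)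
    (V6 : Set Sph)
    (hV6 : V6 = {D.vert a₁, D.vert a₂, D.vert b₁, D.vert b₂, D.vert c₁, D.vert c₂}) :
    -- the curve bounds exactly two regions
    (∃ y₁ y₂ : Sph, y₁ ∉ C ∧ y₂ ∉ C ∧
      connectedComponentIn Cᶜ y₁ ≠ connectedComponentIn Cᶜ y₂ ∧
      ∀ z : Sph, z ∉ C →
        connectedComponentIn Cᶜ z = connectedComponentIn Cᶜ y₁ ∨
        connectedComponentIn Cᶜ z = connectedComponentIn Cᶜ y₂) ∧
    -- at most one region contains no endpoint of e, f, g
    (∀ y₁ y₂ : Sph, y₁ ∉ C → y₂ ∉ C →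
      Disjoint (connectedComponentIn Cᶜ y₁) V6 →
      Disjoint (connectedComponentIn Cᶜ y₂) V6 →
      connectedComponentIn Cᶜ y₁ = connectedComponentIn Cᶜ y₂) := by
  have hC' : C = range ((D.edge a₁ a₂ ha).subpath tef teg) ∪
      (range ((D.edge b₁ b₂ hb).subpath ufe ufg) ∪ range ((D.edge c₁ c₂ hc).subpath vgf vge)) := by
    rw [hC, Path.range_subpath, Path.range_subpath, Path.range_subpath, uIcc_comm vgf vge,
      union_assoc]
  have hnd' := hnd
  simp only [List.nodup_cons, List.mem_cons, List.not_mem_nil, or_false, not_or] at hnd'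
  have nab : ([a₁, a₂, b₁, b₂] : List (Fin n)).Nodup := by simp; grind
  have nac : ([a₁, a₂, c₁, c₂] : List (Fin n)).Nodup := by simp; grind
  have nbc : ([b₁, b₂, c₁, c₂] : List (Fin n)).Nodup := by simp; grind
  have nt : tef ≠ teg := by
    rintro rfl
    exact hD.notMem_inner_of_mem_inner hnd hef'.1 hef'.2 heg'.2
  have nu : ufe ≠ ufg := by
    rintro rfl
    exact hD.notMem_inner_of_mem_inner hnd hef'.1 hef'.2 (hef ▸ hfg'.2)
  have nv : vgf ≠ vge := by
    rintro rfl
    exact hD.notMem_inner_of_mem_inner hnd heg'.1 (heg ▸ hfg ▸ hfg'.1) heg'.2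
  have ra : range ((D.edge a₁ a₂ ha).subpath tef teg) ⊆ D.arc a₁ a₂ := by
    rw [Path.range_subpath, SphereDrawing.arc_eq_range ha]
    exact image_subset_range _ _
  have rb : range ((D.edge b₁ b₂ hb).subpath ufe ufg) ⊆ D.arc b₁ b₂ := by
    rw [Path.range_subpath, SphereDrawing.arc_eq_range hb]
    exact image_subset_range _ _
  have rc : range ((D.edge c₁ c₂ hc).subpath vgf vge) ⊆ D.arc c₁ c₂ := by
    rw [Path.range_subpath, SphereDrawing.arc_eq_range hc]
    exact image_subset_range _ _
  have hv : D.vert a₁ ∉ C := by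
    rw [hC']
    rintro (h | h | h)
    · rw [Path.range_subpath] at h
      exact SphereDrawing.vert_notMem_image_uIcc ha hef'.1 heg'.1 h
    · have := SphereDrawing.eq_or_eq_of_vert_mem_arc (rb h)
      grind
    · have := SphereDrawing.eq_or_eq_of_vert_mem_arc (rc h)
      grind
  have iab := (inter_subset_inter ra rb).trans (hD.arc_inter_arc_subset_singleton nab hef')
  have iac := (inter_subset_inter ra rc).trans (hD.arc_inter_arc_subset_singleton nac heg')
  have ibc := (inter_subset_inter rb rc).trans (hD.arc_inter_arc_subset_singleton nbc hfg')
  obtain ⟨U, V, hU, hV, hUc, hVc, hUV, hUVC⟩ := exists_two_regions_of_three_arcs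
    ((D.edge a₁ a₂ ha).subpath tef teg).continuous ((D.edge b₁ b₂ hb).subpath ufe ufg).continuous
    ((D.edge c₁ c₂ hc).subpath vgf vge).continuous (subpath_injective (D.edge_inj _ _ ha) nt)
    (subpath_injective (D.edge_inj _ _ hb) nu) (subpath_injective (D.edge_inj _ _ hc) nv)
    (by simpa using hef.symm) (by simpa using heg.symm) (by simpa using hfg.symm)
    (by rwa [Path.source])
    (by rwa [Path.target])
    (by rwa [Path.target]) hC' hv
  have compU : ∀ z ∈ U, connectedComponentIn Cᶜ z = U := fun z hz ↦
    hUVC ▸ connectedComponentIn_union_eq_left hU hV hUc hUV hz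
  have compV : ∀ z ∈ V, connectedComponentIn Cᶜ z = V := fun z hz ↦
    hUVC ▸ union_comm U V ▸ connectedComponentIn_union_eq_left hV hU hVc hUV.symm hz
  have hmem : ∀ z ∉ C, z ∈ U ∨ z ∈ V := fun z hz ↦ (hUVC ▸ hz : z ∈ U ∪ V)
  obtain ⟨y₁, hy₁⟩ := hUc.nonempty
  obtain ⟨y₂, hy₂⟩ := hVc.nonempty
  refine ⟨⟨y₁, y₂, (hUVC ▸ .inl hy₁ : y₁ ∈ Cᶜ), (hUVC ▸ .inr hy₂ : y₂ ∈ Cᶜ), ?_, fun z hz ↦ ?_⟩,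
    fun z₁ z₂ hz₁ hz₂ hd₁ hd₂ ↦ ?_⟩
  · rw [compU y₁ hy₁, compV y₂ hy₂]
    rintro rfl
    exact disjoint_left.1 hUV hy₁ hy₁
  · rw [compU y₁ hy₁, compV y₂ hy₂]
    exact (hmem z hz).imp (compU z) (compV z)
  · have hvV6 : D.vert a₁ ∈ V6 := hV6 ▸ .inl rfl
    have hn₁ : D.vert a₁ ∉ connectedComponentIn Cᶜ z₁ := fun h ↦ disjoint_left.1 hd₁ h hvV6
    have hn₂ : D.vert a₁ ∉ connectedComponentIn Cᶜ z₂ := fun h ↦ disjoint_left.1 hd₂ h hvV6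
    rcases hmem z₁ hz₁ with h₁ | h₁ <;> rcases hmem z₂ hz₂ with h₂ | h₂
    · rw [compU z₁ h₁, compU z₂ h₂]
    · rw [compU z₁ h₁] at hn₁
      rw [compV z₂ h₂] at hn₂
      exact ((hmem _ hv).elim hn₁ hn₂).elim
    · rw [compV z₁ h₁] at hn₁
      rw [compU z₂ h₂] at hn₂
      exact ((hmem _ hv).elim hn₂ hn₁).elim
    · rw [compV z₁ h₁, compV z₂ h₂]
end
end

section
/- Let Σ be an arrangement of arcs in the plane in which every two arcs cross, and let P, Q be two internally disjoint dual paths with the same endpoints, each crossing every arc at most once, bounding a disc Δ. If Δ contains at least one vertex of Σ, then Δ contains a vertex v of Σ such that v lies on exactly the arcs for which v is the first vertex encountered when traversing each such arc into Δ from its P-end; consequently v can be slid across P. -/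
open Set unitInterval

noncomputable section

/-- Two sets `S`, `T` cross transversally at `x`: some open neighbourhood of `x` is
homeomorphic to the plane by a chart sending `x` to the origin, `S` onto the horizontal
axis, and `T` onto the vertical axis. -/
def IsLocalCross (S T : Set (ℝ × ℝ)) (x : ℝ × ℝ) : Prop :=
  ∃ (V : Set (ℝ × ℝ)) (_ : IsOpen V) (hx : x ∈ V) (h : V ≃ₜ ℝ × ℝ),
    h ⟨x, hx⟩ = 0 ∧
    (fun q : ℝ × ℝ => (h.symm q : ℝ × ℝ)) ⁻¹' S = {q : ℝ × ℝ | q.2 = 0} ∧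
    (fun q : ℝ × ℝ => (h.symm q : ℝ × ℝ)) ⁻¹' T = {q : ℝ × ℝ | q.1 = 0}

/-- An arrangement of arcs in the plane: a finite set of simple open arcs, each of which
separates the plane, any two of which meet in at most one point, where they cross. -/
structure ArcArrangement where
  arcs : Set (Set (ℝ × ℝ))
  finite : arcs.Finite
  isArc : ∀ S ∈ arcs, ∃ f : ℝ → ℝ × ℝ, Topology.IsEmbedding f ∧ Set.range f = S
  separates : ∀ S ∈ arcs, ¬ IsPreconnected Sᶜ
  meet_once : ∀ S ∈ arcs, ∀ T ∈ arcs, S ≠ T → (S ∩ T).Subsingleton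
  meet_cross : ∀ S ∈ arcs, ∀ T ∈ arcs, S ≠ T → ∀ x ∈ S ∩ T, IsLocalCross S T x

namespace ArcArrangement

/-- The vertices of the arrangement: intersection points of two distinct arcs. -/
def vertexSet (A : ArcArrangement) : Set (ℝ × ℝ) :=
  {x : ℝ × ℝ | ∃ S ∈ A.arcs, ∃ T ∈ A.arcs, S ≠ T ∧ x ∈ S ∩ T}

/-- A path is a "dual path" for the arrangement: it avoids all vertices of the
arrangement and meets each arc at most once. -/
def IsDualPath (A : ArcArrangement) {a b : ℝ × ℝ} (γ : Path a b) : Prop :=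
  Disjoint (Set.range ⇑γ) A.vertexSet ∧
    ∀ S ∈ A.arcs, (Set.range ⇑γ ∩ S).Subsingleton

end ArcArrangement

/-- Sliding a dual path over a vertex of the arrangement: the two paths agree outside a
small open region containing exactly one vertex `v` of the arrangement, around which the
path has been rerouted to the other side. -/
def VertexSlide (A : ArcArrangement) {a b : ℝ × ℝ} (γ γ' : Path a b) : Prop :=
  ∃ (v : ℝ × ℝ) (U : Set (ℝ × ℝ)), v ∈ A.vertexSet ∧ IsOpen U ∧
    A.vertexSet ∩ U = {v} ∧
    ∀ t : unitInterval, γ t ≠ γ' t → (γ t ∈ U ∧ γ' t ∈ U)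

/-- A complex function has a continuous logarithm on a set. -/
def HasLogOn {X : Type*} [TopologicalSpace X] (g : X → ℂ) (K : Set X) : Prop :=
  ∃ ψ : X → ℂ, ContinuousOn ψ K ∧ ∀ x ∈ K, Complex.exp (ψ x) = g x

namespace HasLogOn

variable {X : Type*} [TopologicalSpace X] {g g' : X → ℂ} {K K' : Set X}

theorem mono (h : HasLogOn g K) (hK : K' ⊆ K) : HasLogOn g K' :=
  let ⟨ψ, hc, he⟩ := h
  ⟨ψ, hc.mono hK, fun x hx => he x (hK hx)⟩

theorem congr (h : HasLogOn g K) (hg : ∀ x ∈ K, g x = g' x) : HasLogOn g' K :=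
  let ⟨ψ, hc, he⟩ := h
  ⟨ψ, hc, fun x hx => (he x hx).trans (hg x hx)⟩

theorem mul (h : HasLogOn g K) (h' : HasLogOn g' K) : HasLogOn (fun x => g x * g' x) K :=
  let ⟨ψ, hc, he⟩ := h
  let ⟨ψ', hc', he'⟩ := h'
  ⟨fun x => ψ x + ψ' x, hc.add hc', fun x hx => by
    rw [Complex.exp_add, he x hx, he' x hx]⟩

theorem of_slitPlane (hg : ContinuousOn g K) (h : ∀ x ∈ K, g x ∈ Complex.slitPlane) :
    HasLogOn g K :=
  ⟨fun x => Complex.log (g x), hg.clog h, fun x hx =>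
    Complex.exp_log (Complex.slitPlane_ne_zero (h x hx))⟩

theorem const {c : ℂ} (hc : c ≠ 0) : HasLogOn (fun _ : X => c) K :=
  ⟨fun _ => Complex.log c, continuousOn_const, fun _ _ => Complex.exp_log hc⟩

end HasLogOn

theorem eq_of_exp_eq_one {X : Type*} [TopologicalSpace X] {T : Set X} (hT : IsPreconnected T)
    {d : X → ℂ} (hd : ContinuousOn d T) (he : ∀ x ∈ T, Complex.exp (d x) = 1) {x y : X}
    (hx : x ∈ T) (hy : y ∈ T) : d x = d y :=
  Complex.isCoveringMap_exp.constOn_of_comp hT hd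
    (fun a ha b hb => Subtype.ext ((he a ha).trans (he b hb).symm)) hx hy

theorem HasLogOn.union {X : Type*} [TopologicalSpace X] {g : X → ℂ} {K L : Set X}
    (hK : IsClosed K) (hL : IsClosed L) (hKL : IsPreconnected (K ∩ L))
    (h : HasLogOn g K) (h' : HasLogOn g L) : HasLogOn g (K ∪ L) := by
  classical
  obtain ⟨ψ, hc, he⟩ := h
  obtain ⟨φ, hc', he'⟩ := h'
  obtain ⟨c, hc1, hcK⟩ : ∃ c : ℂ, Complex.exp c = 1 ∧ ∀ x ∈ K ∩ L, ψ x = φ x + c := by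
    rcases (K ∩ L).eq_empty_or_nonempty with h0 | ⟨x, hx⟩
    · exact ⟨0, by simp, by simp [h0]⟩
    · have hone : ∀ y ∈ K ∩ L, Complex.exp (ψ y - φ y) = 1 := fun y hy => by
        rw [Complex.exp_sub, he y hy.1, he' y hy.2, div_self]
        rw [← he y hy.1]; exact Complex.exp_ne_zero _
      refine ⟨ψ x - φ x, hone x hx, fun y hy => ?_⟩
      have := eq_of_exp_eq_one hKL (d := fun y => ψ y - φ y)
        ((hc.mono inter_subset_left).sub (hc'.mono inter_subset_right)) hone hx hy
      rw [this]; ring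
  have e2 : ∀ x ∈ L, K.piecewise ψ (fun y => φ y + c) x = φ x + c := fun x hx => by
    by_cases hxK : x ∈ K
    · rw [piecewise_eq_of_mem _ _ _ hxK, hcK x ⟨hxK, hx⟩]
    · rw [piecewise_eq_of_notMem _ _ _ hxK]
  refine ⟨K.piecewise ψ (fun y => φ y + c), ContinuousOn.union_of_isClosed ?_ ?_ hK hL, ?_⟩
  · exact hc.congr (piecewise_eqOn _ _ _)
  · exact (hc'.add continuousOn_const).congr e2
  · rintro x (hx | hx)
    · rw [piecewise_eq_of_mem _ _ _ hx, he x hx]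
    · rw [e2 x hx, Complex.exp_add, he' x hx, hc1, mul_one]

/-- Every nowhere vanishing continuous complex function on the set has a continuous logarithm. -/
def LogTrivial {X : Type*} [TopologicalSpace X] (K : Set X) : Prop :=
  ∀ g : X → ℂ, ContinuousOn g K → (∀ x ∈ K, g x ≠ 0) → HasLogOn g K

theorem logTrivial_univ {X : Type*} [TopologicalSpace X] [SimplyConnectedSpace X]
    [LocallyPathConnectedSpace X] : LogTrivial (univ : Set X) := by
  intro g hg h0
  obtain ⟨x₀⟩ : Nonempty X := inferInstance
  obtain ⟨f, ⟨-, hf⟩, -⟩ := Complex.isCoveringMapOn_exp.existsUnique_continuousMap_lifts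
    ⟨g, continuousOn_univ.1 hg⟩ (Complex.exp_log (h0 x₀ (mem_univ _))) (fun x => h0 x (mem_univ _))
  exact ⟨f, f.continuous.continuousOn, fun x _ => congrFun hf x⟩

theorem logTrivial_Icc (a b : ℝ) : LogTrivial (Icc a b) := by
  intro g hg h0
  rcases le_or_gt a b with hab | hab
  · have hcont : Continuous (fun x => g (projIcc a b hab x)) :=
      hg.comp_continuous (continuous_subtype_val.comp continuous_projIcc)
        (fun x => (projIcc a b hab x).2)
    obtain ⟨ψ, hψ, he⟩ := logTrivial_univ (X := ℝ) _ hcont.continuousOn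
      (fun x _ => h0 _ (projIcc a b hab x).2)
    exact ⟨ψ, hψ.mono (subset_univ _), fun x hx => by
      simpa only [projIcc_of_mem hab hx] using he x (mem_univ _)⟩
  · exact ⟨0, by simp [Icc_eq_empty_of_lt hab], by simp [Icc_eq_empty_of_lt hab]⟩

theorem LogTrivial.image {X Y : Type*} [TopologicalSpace X] [TopologicalSpace Y] [T2Space Y]
    {K : Set X} (hK : IsCompact K) (h : LogTrivial K) {f : X → Y} (hf : ContinuousOn f K)
    (hinj : InjOn f K) : LogTrivial (f '' K) := by
  intro g hg h0
  obtain ⟨ψ, hψ, he⟩ := h (g ∘ f) (hg.comp hf (mapsTo_image f K))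
    (fun x hx => h0 _ (mem_image_of_mem f hx))
  rcases isEmpty_or_nonempty X with hX | hX
  · exact ⟨0, by simp [eq_empty_of_isEmpty], by simp [eq_empty_of_isEmpty]⟩
  refine ⟨ψ ∘ Function.invFunOn f K, hψ.comp ?_ ?_, ?_⟩
  · rw [continuousOn_iff_isClosed]
    intro t ht
    refine ⟨f '' (K ∩ t), ((hK.inter_right ht).image_of_continuousOn
      (hf.mono inter_subset_left)).isClosed, ?_⟩
    ext y
    constructor
    · rintro ⟨hy, x, hx, rfl⟩
      rw [mem_preimage, hinj.leftInvOn_invFunOn hx] at hy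
      exact ⟨⟨x, ⟨hx, hy⟩, rfl⟩, x, hx, rfl⟩
    · rintro ⟨⟨x, hx, rfl⟩, -⟩
      refine ⟨?_, x, hx.1, rfl⟩
      rw [mem_preimage, hinj.leftInvOn_invFunOn hx.1]
      exact hx.2
  · rintro _ ⟨x, hx, rfl⟩
    exact Function.invFunOn_mem ⟨x, hx, rfl⟩
  · rintro _ ⟨x, hx, rfl⟩
    simp only [Function.comp_apply]
    rw [hinj.leftInvOn_invFunOn hx]
    exact he x hx

theorem LogTrivial.union {X : Type*} [TopologicalSpace X] {K L : Set X} (hK : IsClosed K)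
    (hL : IsClosed L) (hKL : IsPreconnected (K ∩ L)) (h : LogTrivial K) (h' : LogTrivial L) :
    LogTrivial (K ∪ L) := fun g hg h0 =>
  (h g (hg.mono subset_union_left) fun x hx => h0 x (Or.inl hx)).union hK hL hKL
    (h' g (hg.mono subset_union_right) fun x hx => h0 x (Or.inr hx))

/-- The plane `ℝ × ℝ` identified with the complex numbers. -/
def toComplex : (ℝ × ℝ) ≃L[ℝ] ℂ := Complex.equivRealProdCLM.symm

theorem toComplex_sub_ne_zero {x p : ℝ × ℝ} (h : x ≠ p) : toComplex x - toComplex p ≠ 0 :=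
  sub_ne_zero.2 fun h' => h (toComplex.injective h')

/-- The point `p` is not enclosed by `K`: the function `x ↦ x - p` has a continuous logarithm
on `K`. For compact `K` this says that `p` lies in the unbounded component of `Kᶜ`. -/
def Outside (K : Set (ℝ × ℝ)) (p : ℝ × ℝ) : Prop :=
  HasLogOn (fun x => toComplex x - toComplex p) K

theorem Outside.of_norm_lt {K : Set (ℝ × ℝ)} {p p' : ℝ × ℝ} (h : Outside K p)
    (hlt : ∀ x ∈ K, ‖toComplex p - toComplex p'‖ < ‖toComplex x - toComplex p‖) :
    Outside K p' := by
  have hne : ∀ x ∈ K, toComplex x - toComplex p ≠ 0 := fun x hx =>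
    norm_pos_iff.1 ((norm_nonneg _).trans_lt (hlt x hx))
  have h2 : HasLogOn (fun x => 1 + (toComplex p - toComplex p') / (toComplex x - toComplex p))
      K := by
    refine HasLogOn.of_slitPlane ?_ fun x hx => Complex.mem_slitPlane_of_norm_lt_one ?_
    · exact continuousOn_const.add (continuousOn_const.div
        (toComplex.continuous.continuousOn.sub continuousOn_const) hne)
    · rw [norm_div, div_lt_one (norm_pos_iff.2 (hne x hx))]
      exact hlt x hx
  refine (h.mul h2).congr fun x hx => ?_
  have := hne x hx
  field_simp
  ring

theorem exists_norm_bound {K : Set (ℝ × ℝ)} (hK : Bornology.IsBounded K) :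
    ∃ R : ℝ, 0 < R ∧ ∀ x ∈ K, ‖toComplex x‖ < R := by
  obtain ⟨R, hR, h⟩ := (hK.image (toComplex : (ℝ × ℝ) →L[ℝ] ℂ)).exists_pos_norm_lt
  exact ⟨R, hR, fun x hx => h _ (mem_image_of_mem _ hx)⟩

theorem isBounded_of_norm_le {K : Set (ℝ × ℝ)} {R : ℝ} (h : ∀ x ∈ K, ‖toComplex x‖ ≤ R) :
    Bornology.IsBounded K := by
  have h1 : Bornology.IsBounded (toComplex '' K) :=
    isBounded_iff_forall_norm_le.2 ⟨R, by rintro _ ⟨x, hx, rfl⟩; exact h x hx⟩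
  have h2 := h1.image (toComplex.symm : ℂ →L[ℝ] ℝ × ℝ)
  simpa [image_image] using h2

theorem exists_norm_gap {K : Set (ℝ × ℝ)} (hK : IsClosed K) {p : ℝ × ℝ} (hp : p ∉ K) :
    ∃ ε > 0, ∀ x ∈ K, ε ≤ ‖toComplex x - toComplex p‖ := by
  have h : toComplex.symm ⁻¹' Kᶜ ∈ nhds (toComplex p) :=
    toComplex.symm.continuous.continuousAt.preimage_mem_nhds
      (by rw [toComplex.symm_apply_apply]; exact hK.isOpen_compl.mem_nhds hp)
  obtain ⟨ε, hε, hb⟩ := Metric.mem_nhds_iff.1 h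
  refine ⟨ε, hε, fun x hx => ?_⟩
  by_contra hlt
  have := hb (mem_ball_iff_norm.2 (not_le.1 hlt))
  rw [mem_preimage, toComplex.symm_apply_apply] at this
  exact this hx

theorem outside_eventually_iff {K : Set (ℝ × ℝ)} (hK : IsClosed K) {p : ℝ × ℝ} (hp : p ∉ K) :
    ∀ᶠ p' in nhds p, Outside K p' ↔ Outside K p := by
  obtain ⟨ε, hε, hgap⟩ := exists_norm_gap hK hp
  have hc : ContinuousAt (fun p' => ‖toComplex p' - toComplex p‖) p := by fun_prop
  have hev : ∀ᶠ p' in nhds p, ‖toComplex p' - toComplex p‖ < ε / 2 :=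
    hc.eventually_lt continuousAt_const (by simp [hε])
  filter_upwards [hev] with p' hp'
  constructor
  · refine fun h => h.of_norm_lt fun x hx => ?_
    have h1 := hgap x hx
    have h2 := norm_sub_le_norm_sub_add_norm_sub (toComplex x) (toComplex p') (toComplex p)
    linarith
  · refine fun h => h.of_norm_lt fun x hx => ?_
    rw [norm_sub_rev]
    linarith [hgap x hx]

theorem isOpen_outside {K : Set (ℝ × ℝ)} (hK : IsClosed K) :
    IsOpen {p | p ∉ K ∧ Outside K p} :=
  isOpen_iff_eventually.2 fun p hp => by
    filter_upwards [hK.isOpen_compl.mem_nhds hp.1, outside_eventually_iff hK hp.1] with q h1 h2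
    exact ⟨h1, h2.2 hp.2⟩

theorem isOpen_inside {K : Set (ℝ × ℝ)} (hK : IsClosed K) :
    IsOpen {p | p ∉ K ∧ ¬ Outside K p} :=
  isOpen_iff_eventually.2 fun p hp => by
    filter_upwards [hK.isOpen_compl.mem_nhds hp.1, outside_eventually_iff hK hp.1] with q h1 h2
    exact ⟨h1, fun h => hp.2 (h2.1 h)⟩

theorem Outside.of_isPreconnected {K T : Set (ℝ × ℝ)} (hK : IsClosed K) (hT : IsPreconnected T)
    (hTK : Disjoint T K) {p q : ℝ × ℝ} (hp : p ∈ T) (hq : q ∈ T) (h : Outside K p) :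
    Outside K q := by
  have hn : ∀ x ∈ T, x ∉ K := fun x hx hxK => disjoint_left.1 hTK hx hxK
  refine (hT.subset_left_of_subset_union (isOpen_outside hK) (isOpen_inside hK) ?_ ?_ ?_ hq).2
  · exact disjoint_left.2 fun x h1 h2 => h2.2 h1.2
  · intro x hx
    by_cases h : Outside K x
    · exact Or.inl ⟨hn x hx, h⟩
    · exact Or.inr ⟨hn x hx, h⟩
  · exact ⟨p, hp, hn p hp, h⟩

theorem outside_of_norm_lt {K : Set (ℝ × ℝ)} {p : ℝ × ℝ}
    (h : ∀ x ∈ K, ‖toComplex x‖ < ‖toComplex p‖) : Outside K p := by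
  rcases K.eq_empty_or_nonempty with rfl | ⟨x₀, hx₀⟩
  · exact ⟨0, by simp, by simp⟩
  have hp : toComplex p ≠ 0 := norm_pos_iff.1 ((norm_nonneg _).trans_lt (h x₀ hx₀))
  have h2 : HasLogOn (fun x => 1 + -(toComplex x / toComplex p)) K := by
    refine HasLogOn.of_slitPlane ?_ fun x hx => Complex.mem_slitPlane_of_norm_lt_one ?_
    · have := toComplex.continuous
      fun_prop
    · rw [norm_neg, norm_div, div_lt_one (norm_pos_iff.2 hp)]
      exact h x hx
  refine ((HasLogOn.const (neg_ne_zero.2 hp)).mul h2).congr fun x _ => ?_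
  field_simp
  ring

theorem isBounded_inside {K : Set (ℝ × ℝ)} (hK : Bornology.IsBounded K) :
    Bornology.IsBounded {p | p ∉ K ∧ ¬ Outside K p} := by
  obtain ⟨R, -, h⟩ := exists_norm_bound hK
  refine isBounded_of_norm_le (R := R) fun p hp => ?_
  by_contra hlt
  exact hp.2 (outside_of_norm_lt fun x hx => (h x hx).trans (not_le.1 hlt))

theorem LogTrivial.outside {K : Set (ℝ × ℝ)} (hK : LogTrivial K) {p : ℝ × ℝ} (hp : p ∉ K) :
    Outside K p :=
  hK _ (toComplex.continuous.continuousOn.sub continuousOn_const)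
    fun _ hx => toComplex_sub_ne_zero fun h => hp (h ▸ hx)

theorem not_hasLogOn_circle {p : ℝ × ℝ} {R : ℝ} (hR : 0 < R) :
    ¬ HasLogOn (fun x => toComplex x - toComplex p) {x | ‖toComplex x - toComplex p‖ = R} := by
  rintro ⟨ψ, hψ, he⟩
  let c : ℝ → ℝ × ℝ := fun θ => toComplex.symm (toComplex p + R * Complex.exp (θ * Complex.I))
  have hc : Continuous c := toComplex.symm.continuous.comp (by fun_prop)
  have hcv : ∀ θ, toComplex (c θ) - toComplex p = R * Complex.exp (θ * Complex.I) := fun θ => by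
    simp only [c, ContinuousLinearEquiv.apply_symm_apply]; ring
  have hcm : ∀ θ, ‖toComplex (c θ) - toComplex p‖ = R := fun θ => by
    rw [hcv, norm_mul, Complex.norm_exp_ofReal_mul_I, mul_one, Complex.norm_real,
      Real.norm_of_nonneg hR.le]
  have hR' : (R : ℂ) ≠ 0 := by exact_mod_cast hR.ne'
  have h1 := eq_of_exp_eq_one (T := (univ : Set ℝ)) isPreconnected_univ
    (d := fun θ => ψ (c θ) - θ * Complex.I - Complex.log R)
    (((hψ.comp hc.continuousOn fun θ _ => hcm θ).sub (by fun_prop)).sub continuousOn_const)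
    (fun θ _ => by
      rw [Complex.exp_sub, Complex.exp_sub, (he _ (hcm θ)).trans (hcv θ), Complex.exp_log hR']
      field_simp [Complex.exp_ne_zero]) (mem_univ 0) (mem_univ (2 * Real.pi))
  have h2 : c (2 * Real.pi) = c 0 := by
    simp [c, Complex.exp_two_pi_mul_I]
  simp only [h2, Complex.ofReal_zero, zero_mul, sub_zero] at h1
  have h3 : ((2 * Real.pi : ℝ) : ℂ) * Complex.I = 0 := by linear_combination h1
  simp [Real.pi_ne_zero] at h3

/-- A bounded set is enclosed by any compact set containing its frontier. -/
theorem not_outside_of_frontier_subset {K U : Set (ℝ × ℝ)}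
    (hUb : Bornology.IsBounded U) (hfr : frontier U ⊆ K) {p : ℝ × ℝ} (hp : p ∈ U) :
    ¬ Outside K p := by
  classical
  rintro h
  obtain ⟨ψ, hψ, he⟩ := h.mono hfr
  obtain ⟨Ψ, hΨ⟩ := ContinuousMap.exists_restrict_eq isClosed_frontier
    ⟨(frontier U).domRestrict ψ, continuousOn_iff_continuous_domRestrict.1 hψ⟩
  have hΨ' : ∀ x ∈ frontier U, Ψ x = ψ x := fun x hx => congrArg (fun f => f ⟨x, hx⟩) hΨ
  let g : ℝ × ℝ → ℂ := (closure U).piecewise (fun x => Complex.exp (Ψ x))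
    (fun x => toComplex x - toComplex p)
  have hg : Continuous g := by
    refine Continuous.piecewise (fun x hx => ?_) (by fun_prop)
      (toComplex.continuous.sub continuous_const)
    have hx' := frontier_closure_subset hx
    rw [hΨ' x hx', he x hx']
  obtain ⟨φ, hφ, hφe⟩ := logTrivial_univ g hg.continuousOn fun x _ => by
    by_cases hx : x ∈ closure U
    · simp only [g, piecewise_eq_of_mem _ _ _ hx]; exact Complex.exp_ne_zero _
    · simp only [g, piecewise_eq_of_notMem _ _ _ hx]
      exact toComplex_sub_ne_zero fun h => hx (h ▸ subset_closure hp)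
  obtain ⟨R, hR, hb⟩ := exists_norm_bound hUb.closure
  refine not_hasLogOn_circle (p := p) (R := R + ‖toComplex p‖) (by positivity)
    ⟨φ, hφ.mono (subset_univ _), fun x hx => ?_⟩
  rw [hφe x (mem_univ _)]
  have hx' : x ∉ closure U := fun hxU => by
    have h1 := hb x hxU
    have h2 := norm_sub_le (toComplex x) (toComplex p)
    rw [mem_ofPred_eq] at hx
    linarith
  simp only [g, piecewise_eq_of_notMem _ _ _ hx']

theorem Outside.union {K L : Set (ℝ × ℝ)} {p : ℝ × ℝ} (hK : IsClosed K) (hL : IsClosed L)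
    (hKL : IsPreconnected (K ∩ L)) (h : Outside K p) (h' : Outside L p) : Outside (K ∪ L) p :=
  HasLogOn.union hK hL hKL h h'

theorem mem_of_mem_closure_outside {K : Set (ℝ × ℝ)} (hK : IsClosed K) {x : ℝ × ℝ}
    (hx : x ∈ closure {w | w ∉ K ∧ Outside K w}) (hxK : x ∉ K) : Outside K x := by
  by_contra h
  obtain ⟨y, hy, hy'⟩ := mem_closure_iff.1 hx _ (isOpen_inside hK) ⟨hxK, h⟩
  exact hy.2 hy'.2

theorem mem_of_mem_closure_inside {K : Set (ℝ × ℝ)} (hK : IsClosed K) {x : ℝ × ℝ}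
    (hx : x ∈ closure {w | w ∉ K ∧ ¬ Outside K w}) (hxK : x ∉ K) : ¬ Outside K x := by
  intro h
  obtain ⟨y, hy, hy'⟩ := mem_closure_iff.1 hx _ (isOpen_outside hK) ⟨hxK, h⟩
  exact hy'.2 hy.2

theorem exists_mem_frontier_notMem {U B : Set (ℝ × ℝ)} (hUb : Bornology.IsBounded U)
    (hU : U.Nonempty) (hB : LogTrivial B) (hUB : Disjoint U B) : ∃ y ∈ frontier U, y ∉ B := by
  by_contra! hc
  obtain ⟨p, hp⟩ := hU
  exact not_outside_of_frontier_subset hUb hc hp (hB.outside (disjoint_left.1 hUB hp))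

theorem exists_mem_closure_outside {K B : Set (ℝ × ℝ)} (hK : IsCompact K) {p : ℝ × ℝ}
    (hp : p ∉ K) (h : ¬ Outside K p) (hBK : B ⊆ K) (hBc : IsClosed B) (hB : LogTrivial B) :
    ∃ x ∈ K, x ∉ B ∧ x ∈ closure {w | w ∉ K ∧ Outside K w} := by
  by_contra! hc
  set W := {w | w ∉ K ∧ Outside K w}
  have hbd : Bornology.IsBounded (closure W ∪ B)ᶜ := by
    refine (hK.isBounded.union (isBounded_inside hK.isBounded)).subset fun x hx => ?_
    by_cases hxK : x ∈ K
    · exact Or.inl hxK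
    · exact Or.inr ⟨hxK, fun h => hx (Or.inl (subset_closure ⟨hxK, h⟩))⟩
  have hpU : p ∈ (closure W ∪ B)ᶜ := fun h' =>
    h'.elim (fun h1 => h (mem_of_mem_closure_outside hK.isClosed h1 hp)) fun h1 => hp (hBK h1)
  obtain ⟨y, hy, hyB⟩ := exists_mem_frontier_notMem hbd ⟨p, hpU⟩ hB
    (disjoint_left.2 fun x hx hxB => hx (Or.inr hxB))
  rw [frontier_compl] at hy
  have hyW : y ∈ closure W := ((isClosed_closure.union hBc).frontier_subset hy).resolve_right hyB
  have hyK : y ∉ K := fun hyK => hc y hyK hyB hyW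
  refine hy.2 (mem_interior.2 ⟨W, subset_closure.trans subset_union_left,
    isOpen_outside hK.isClosed, hyK, mem_of_mem_closure_outside hK.isClosed hyW hyK⟩)

theorem Outside.of_disjoint {K L : Set (ℝ × ℝ)} (hK : IsClosed K) (hL : IsCompact L)
    {w : ℝ × ℝ} (hwK : w ∉ K) (hw : Outside K w) (hd : ∀ x ∈ L, x ∉ K → ¬ Outside K x) :
    Outside L w := by
  by_contra h
  have hwL : w ∉ L := fun hwL => hd w hwL hwK hw
  set U := {y | y ∉ L ∧ ¬ Outside L y} ∩ {y | y ∉ K ∧ Outside K y}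
  have hU : IsOpen U := (isOpen_inside hL.isClosed).inter (isOpen_outside hK)
  refine not_outside_of_frontier_subset (U := U) (K := K) (p := w)
    ((isBounded_inside hL.isBounded).subset inter_subset_left) ?_ ⟨⟨hwL, h⟩, hwK, hw⟩ hw
  intro x hx
  by_contra hxK
  have h1 : Outside K x :=
    mem_of_mem_closure_outside hK (closure_mono inter_subset_right hx.1) hxK
  have hxL : x ∉ L := fun hxL => hd x hxL hxK h1
  have h2 := mem_of_mem_closure_inside hL.isClosed (closure_mono inter_subset_left hx.1) hxL
  exact hx.2 (hU.interior_eq.symm ▸ ⟨⟨hxL, h2⟩, hxK, h1⟩)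

/-- Near `y`, the set `J` can be cut so that the remainder is closed and does not enclose
anything. -/
def ArcLike (J : Set (ℝ × ℝ)) (y : ℝ × ℝ) : Prop :=
  ∀ N ∈ nhds y, ∃ B ⊆ J, IsClosed B ∧ LogTrivial B ∧ J \ B ⊆ N

theorem ArcLike.mem_closure {J C : Set (ℝ × ℝ)} {y : ℝ × ℝ} (h : ArcLike J y)
    (hC : Bornology.IsBounded C) (hCn : C.Nonempty) (hfr : frontier C ⊆ J)
    (hd : Disjoint C J) : y ∈ closure C := by
  refine mem_closure_iff_nhds.2 fun N hN => ?_
  obtain ⟨N', hN', hN'o, hyN'⟩ := mem_nhds_iff.1 hN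
  obtain ⟨B, hBJ, -, hB, hJB⟩ := h N' (hN'o.mem_nhds hyN')
  obtain ⟨x, hx, hxB⟩ := exists_mem_frontier_notMem hC hCn hB (hd.mono_right hBJ)
  have hx' := mem_closure_iff.1 hx.1 N' hN'o (hJB ⟨hfr hx, hxB⟩)
  exact hx'.mono (inter_subset_inter_left _ hN')

theorem ArcLike.outside {J C L : Set (ℝ × ℝ)} {y : ℝ × ℝ} (h : ArcLike J y) (hJ : IsCompact J)
    (hC : Bornology.IsBounded C) (hCn : C.Nonempty) (hfr : frontier C ⊆ J)
    (hd : Disjoint C J) (hL : IsCompact L) (hLC : L ⊆ C ∪ J) (hyL : y ∉ L) :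
    Outside L y := by
  have hCin : ∀ x ∈ C, ¬ Outside J x := fun x hx => not_outside_of_frontier_subset hC hfr hx
  obtain ⟨N, hN, hNo, hyN⟩ := mem_nhds_iff.1 (outside_eventually_iff hL.isClosed hyL)
  obtain ⟨B, hBJ, hBc, hB, hJB⟩ := h N (hNo.mem_nhds hyN)
  obtain ⟨p, hp⟩ := hCn
  obtain ⟨x, hxJ, hxB, hx⟩ := exists_mem_closure_outside hJ (disjoint_left.1 hd hp)
    (hCin p hp) hBJ hBc hB
  obtain ⟨w, hwN, hwJ, hw⟩ := mem_closure_iff.1 hx N hNo (hJB ⟨hxJ, hxB⟩)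
  exact (hN hwN).1 (hw.of_disjoint hJ.isClosed hL hwJ fun u hu huJ =>
    hCin u ((hLC hu).resolve_right huJ))

theorem ArcLike.eventually_not_outside {J C L L' : Set (ℝ × ℝ)} {y : ℝ × ℝ} (h : ArcLike J y)
    (hJ : IsCompact J) (hC : Bornology.IsBounded C) (hfr : frontier C ⊆ J)
    (hd : Disjoint C J) (hL : IsCompact L) (hL' : IsCompact L') (hJL : J ⊆ L ∪ L')
    (hLL : IsPreconnected (L ∩ L')) (hLC' : L' ⊆ C ∪ J) (hyL : y ∉ L') :
    ∀ᶠ x in nhds y, x ∈ C → ¬ Outside L x := by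
  rcases C.eq_empty_or_nonempty with rfl | hCn
  · simp
  have hy := h.outside hJ hC hCn hfr hd hL' hLC' hyL
  filter_upwards [outside_eventually_iff hL'.isClosed hyL] with x hx hxC hxL
  exact not_outside_of_frontier_subset hC hfr hxC
    (HasLogOn.mono (Outside.union hL.isClosed hL'.isClosed hLL hxL (hx.2 hy)) hJL)

theorem arcLike_of_loop {f : ℝ → ℝ × ℝ} {s α r : ℝ} {R : Set (ℝ × ℝ)}
    (hf : ContinuousOn f (Icc s α)) (hinj : InjOn f (Icc s α)) (hR : IsCompact R)
    (hRt : LogTrivial R) (hRf : ∀ x ∈ Icc s α, f x ∈ R → x = s ∨ x = α) (hs : f s ∈ R)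
    (hα : f α ∈ R) (hsr : s < r) (hrα : r < α) : ArcLike (f '' Icc s α ∪ R) (f r) := by
  intro N hN
  have hIcc : Icc s α ∈ nhds r := Icc_mem_nhds hsr hrα
  obtain ⟨l, u, hlu, hluN⟩ := mem_nhds_iff_exists_Ioo_subset.1
    (Filter.inter_mem (hf.continuousAt hIcc hN) (Ioo_mem_nhds hsr hrα))
  have hsl : s ≤ l := ((Ioo_subset_Ioo_iff (hlu.1.trans hlu.2)).1
    fun x hx => (hluN hx).2).1
  have huα : u ≤ α := ((Ioo_subset_Ioo_iff (hlu.1.trans hlu.2)).1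
    fun x hx => (hluN hx).2).2
  have hl : Icc s l ⊆ Icc s α := Icc_subset_Icc_right (hlu.1.le.trans hrα.le)
  have hu : Icc u α ⊆ Icc s α := Icc_subset_Icc_left (hsr.le.trans hlu.2.le)
  have hcl : IsCompact (f '' Icc s l) := isCompact_Icc.image_of_continuousOn (hf.mono hl)
  have hcu : IsCompact (f '' Icc u α) := isCompact_Icc.image_of_continuousOn (hf.mono hu)
  have hsα : α ∈ Icc s α := right_mem_Icc.2 (hsr.trans hrα).le
  have h1 : f '' Icc s l ∩ R = {f s} := by
    refine Subset.antisymm ?_ (singleton_subset_iff.2 ⟨⟨s, left_mem_Icc.2 hsl, rfl⟩, hs⟩)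
    rintro _ ⟨⟨x, hx, rfl⟩, hxR⟩
    rcases hRf x (hl hx) hxR with rfl | rfl
    · rfl
    · exact absurd (hx.2.trans_lt (hlu.1.trans hrα)) (lt_irrefl _)
  have h2 : (f '' Icc s l ∪ R) ∩ f '' Icc u α = {f α} := by
    refine Subset.antisymm ?_ (singleton_subset_iff.2 ⟨Or.inr hα, α, right_mem_Icc.2 huα, rfl⟩)
    rintro _ ⟨⟨x, hx, hxy⟩ | hyR, ⟨y, hy, rfl⟩⟩
    · have := hinj (hl hx) (hu hy) hxy
      exact absurd (hlu.1.trans (hlu.2.trans_le hy.1)) (this ▸ hx.2).not_gt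
    · rcases hRf y (hu hy) hyR with rfl | rfl
      · exact absurd ((hsr.trans hlu.2).trans_le hy.1) (lt_irrefl _)
      · rfl
  refine ⟨f '' Icc s l ∪ R ∪ f '' Icc u α, ?_, (hcl.union hR |>.union hcu).isClosed, ?_, ?_⟩
  · rintro x ((hx | hx) | hx)
    · exact Or.inl (image_mono hl hx)
    · exact Or.inr hx
    · exact Or.inl (image_mono hu hx)
  · refine LogTrivial.union (hcl.union hR).isClosed hcu.isClosed
      (h2 ▸ isPreconnected_singleton) (LogTrivial.union hcl.isClosed hR.isClosed
        (h1 ▸ isPreconnected_singleton) ?_ hRt) ?_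
    · exact (logTrivial_Icc s l).image isCompact_Icc (hf.mono hl) (hinj.mono hl)
    · exact (logTrivial_Icc u α).image isCompact_Icc (hf.mono hu) (hinj.mono hu)
  · rintro _ ⟨⟨x, hx, rfl⟩ | hx, hxB⟩
    · refine (hluN ⟨?_, ?_⟩).1
      · by_contra hxl
        exact hxB (Or.inl (Or.inl ⟨x, ⟨hx.1, not_lt.1 hxl⟩, rfl⟩))
      · by_contra hxu
        exact hxB (Or.inr ⟨x, ⟨not_lt.1 hxu, hx.2⟩, rfl⟩)
    · exact absurd (Or.inl (Or.inr hx)) hxB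

/-- `C` is a bounded open set whose frontier lies on the closed curve formed by two arcs `p` and
`q` with common end points. -/
structure IsBigon (p q : ℝ → ℝ × ℝ) (C : Set (ℝ × ℝ)) : Prop where
  continuous_fst : Continuous p
  continuous_snd : Continuous q
  injOn_fst : InjOn p (Icc 0 1)
  injOn_snd : InjOn q (Icc 0 1)
  start_eq : p 0 = q 0
  end_eq : p 1 = q 1
  meet : ∀ s ∈ Icc (0 : ℝ) 1, ∀ t ∈ Icc (0 : ℝ) 1, p s = q t → s = 0 ∨ s = 1
  isOpen : IsOpen C
  isBounded : Bornology.IsBounded C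
  nonempty : C.Nonempty
  frontier_subset : frontier C ⊆ p '' Icc 0 1 ∪ q '' Icc 0 1
  disjoint : Disjoint C (p '' Icc 0 1 ∪ q '' Icc 0 1)

namespace IsBigon

variable {p q : ℝ → ℝ × ℝ} {C : Set (ℝ × ℝ)}

theorem meet_snd (h : IsBigon p q C) {s t : ℝ} (hs : s ∈ Icc (0 : ℝ) 1) (ht : t ∈ Icc (0 : ℝ) 1)
    (hst : p s = q t) : t = 0 ∨ t = 1 := by
  rcases h.meet s hs t ht hst with rfl | rfl
  · exact Or.inl (h.injOn_snd ht (by simp) (hst.symm.trans h.start_eq))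
  · exact Or.inr (h.injOn_snd ht (by simp) (hst.symm.trans h.end_eq))

theorem symm (h : IsBigon p q C) : IsBigon q p C where
  continuous_fst := h.continuous_snd
  continuous_snd := h.continuous_fst
  injOn_fst := h.injOn_snd
  injOn_snd := h.injOn_fst
  start_eq := h.start_eq.symm
  end_eq := h.end_eq.symm
  meet := fun _ hs _ ht hst => h.meet_snd ht hs hst.symm
  isOpen := h.isOpen
  isBounded := h.isBounded
  nonempty := h.nonempty
  frontier_subset := union_comm (p '' _) _ ▸ h.frontier_subset
  disjoint := union_comm (p '' _) _ ▸ h.disjoint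

theorem isCompact_fst (h : IsBigon p q C) (a b : ℝ) : IsCompact (p '' Icc a b) :=
  isCompact_Icc.image h.continuous_fst

theorem isCompact_boundary (h : IsBigon p q C) : IsCompact (p '' Icc 0 1 ∪ q '' Icc 0 1) :=
  (h.isCompact_fst 0 1).union (h.symm.isCompact_fst 0 1)

theorem fst_notMem (h : IsBigon p q C) {r : ℝ} (hr : r ∈ Icc (0 : ℝ) 1) : p r ∉ C := fun hC =>
  disjoint_left.1 h.disjoint hC (Or.inl ⟨r, hr, rfl⟩)

theorem arcLike_fst (h : IsBigon p q C) {r : ℝ} (hr : r ∈ Ioo (0 : ℝ) 1) :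
    ArcLike (p '' Icc 0 1 ∪ q '' Icc 0 1) (p r) :=
  arcLike_of_loop h.continuous_fst.continuousOn h.injOn_fst (h.symm.isCompact_fst 0 1)
    ((logTrivial_Icc 0 1).image isCompact_Icc h.continuous_snd.continuousOn h.injOn_snd)
    (fun x hx ⟨t, ht, htx⟩ => h.meet x hx t ht htx.symm)
    ⟨0, by simp, h.start_eq.symm⟩ ⟨1, by simp, h.end_eq.symm⟩ hr.1 hr.2

theorem arcLike_snd (h : IsBigon p q C) {r : ℝ} (hr : r ∈ Ioo (0 : ℝ) 1) :
    ArcLike (p '' Icc 0 1 ∪ q '' Icc 0 1) (q r) :=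
  union_comm (q '' _) _ ▸ h.symm.arcLike_fst hr

theorem fst_mem_closure (h : IsBigon p q C) {r : ℝ} (hr : r ∈ Ioo (0 : ℝ) 1) : p r ∈ closure C :=
  (h.arcLike_fst hr).mem_closure h.isBounded h.nonempty h.frontier_subset h.disjoint

theorem outside (h : IsBigon p q C) {L : Set (ℝ × ℝ)} (hL : IsCompact L)
    (hLC : L ⊆ C ∪ (p '' Icc 0 1 ∪ q '' Icc 0 1)) {y : ℝ × ℝ}
    (hy : ArcLike (p '' Icc 0 1 ∪ q '' Icc 0 1) y) (hyL : y ∉ L) : Outside L y :=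
  hy.outside h.isCompact_boundary h.isBounded h.nonempty h.frontier_subset h.disjoint hL hLC hyL

/-- A connected set joining two boundary points through `C` encloses, together with the boundary
arc between these points, the part of `C` near that arc. -/
theorem eventually_not_outside (h : IsBigon p q C) {X : Set (ℝ × ℝ)} {a b r : ℝ}
    (hX : IsCompact X) (hXc : IsPreconnected X) (hXC : X ⊆ C ∪ {p a, p b}) (ha : p a ∈ X)
    (hb : p b ∈ X) (ha0 : 0 ≤ a) (har : a < r) (hrb : r < b) (hb1 : b ≤ 1) :
    ∀ᶠ x in nhds (p r), x ∈ C → ¬ Outside (X ∪ p '' Icc a b) x := by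
  have hr : r ∈ Ioo (0 : ℝ) 1 := ⟨ha0.trans_lt har, hrb.trans_le hb1⟩
  have hr' : r ∈ Icc (0 : ℝ) 1 := Ioo_subset_Icc_self hr
  have haI : a ∈ Icc (0 : ℝ) 1 := ⟨ha0, (har.trans hr.2).le⟩
  have hbI : b ∈ Icc (0 : ℝ) 1 := ⟨(hr.1.trans hrb).le, hb1⟩
  have hXJ : ∀ x ∈ Icc (0 : ℝ) 1, p x ∈ X → x = a ∨ x = b := fun x hx hxX => by
    rcases hXC hxX with hC | hab | hab
    · exact absurd hC (h.fst_notMem hx)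
    · exact Or.inl (h.injOn_fst hx haI hab)
    · exact Or.inr (h.injOn_fst hx hbI hab)
  have hcap : (X ∪ p '' Icc a b) ∩ (X ∪ (p '' Icc 0 a ∪ p '' Icc b 1 ∪ q '' Icc 0 1)) = X := by
    refine Subset.antisymm ?_ (subset_inter subset_union_left subset_union_left)
    rintro x ⟨hx | ⟨s, hs, rfl⟩, hx' | ((⟨t, ht, hst⟩ | ⟨t, ht, hst⟩) | ⟨t, ht, hst⟩)⟩
    · exact hx
    · exact hx
    · exact hx
    · exact hx
    · exact hx'
    · have := h.injOn_fst ⟨ht.1, ht.2.trans haI.2⟩ ⟨ha0.trans hs.1, hs.2.trans hb1⟩ hst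
      have : s = a := le_antisymm (this ▸ ht.2) hs.1
      exact this ▸ ha
    · have := h.injOn_fst ⟨hbI.1.trans ht.1, ht.2⟩ ⟨ha0.trans hs.1, hs.2.trans hb1⟩ hst
      have : s = b := le_antisymm hs.2 (this ▸ ht.1)
      exact this ▸ hb
    · rcases h.meet s ⟨ha0.trans hs.1, hs.2.trans hb1⟩ t ht hst.symm with h0 | h0
      · have : s = a := le_antisymm (h0 ▸ ha0) hs.1
        exact this ▸ ha
      · have : s = b := le_antisymm hs.2 (h0 ▸ hb1)
        exact this ▸ hb
  have hXb : X ⊆ C ∪ (p '' Icc 0 1 ∪ q '' Icc 0 1) := hXC.trans (union_subset_union_right _ (by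
    rintro x (rfl | rfl)
    exacts [Or.inl ⟨a, haI, rfl⟩, Or.inl ⟨b, hbI, rfl⟩]))
  refine (h.arcLike_fst hr).eventually_not_outside h.isCompact_boundary h.isBounded
    h.frontier_subset h.disjoint (hX.union (h.isCompact_fst a b))
    (L' := X ∪ (p '' Icc 0 a ∪ p '' Icc b 1 ∪ q '' Icc 0 1))
    (hX.union (((h.isCompact_fst 0 a).union (h.isCompact_fst b 1)).union
      (h.symm.isCompact_fst 0 1))) ?_ (hcap.symm ▸ hXc) ?_ ?_
  · rintro x (⟨s, hs, rfl⟩ | hx)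
    · rcases le_total s a with hsa | hsa
      · exact Or.inr (Or.inr (Or.inl (Or.inl ⟨s, ⟨hs.1, hsa⟩, rfl⟩)))
      · rcases le_total s b with hsb | hsb
        · exact Or.inl (Or.inr ⟨s, ⟨hsa, hsb⟩, rfl⟩)
        · exact Or.inr (Or.inr (Or.inl (Or.inr ⟨s, ⟨hsb, hs.2⟩, rfl⟩)))
    · exact Or.inr (Or.inr (Or.inr hx))
  · rintro x (hx | ((hx | hx) | hx))
    · exact hXb hx
    · exact Or.inr (Or.inl (image_mono (Icc_subset_Icc_right haI.2) hx))
    · exact Or.inr (Or.inl (image_mono (Icc_subset_Icc_left hbI.1) hx))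
    · exact Or.inr (Or.inr hx)
  · rintro (hx | ((⟨t, ht, hst⟩ | ⟨t, ht, hst⟩) | ⟨t, ht, hst⟩))
    · rcases hXJ r hr' hx with h0 | h0
      exacts [har.ne' h0, hrb.ne h0]
    · have := h.injOn_fst ⟨ht.1, ht.2.trans haI.2⟩ hr' hst
      exact har.not_ge (this ▸ ht.2)
    · have := h.injOn_fst ⟨hbI.1.trans ht.1, ht.2⟩ hr' hst
      exact hrb.not_ge (this ▸ ht.1)
    · rcases h.meet r hr' t ht hst.symm with h0 | h0
      exacts [hr.1.ne' h0, hr.2.ne h0]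

end IsBigon

/-- The curve `f` crosses `C` once, entering through `p τ` at time `s` and leaving through `q κ`
at time `t`. -/
structure IsChord (p q : ℝ → ℝ × ℝ) (C : Set (ℝ × ℝ)) (f : ℝ → ℝ × ℝ) (s t τ κ : ℝ) : Prop where
  continuous : Continuous f
  injective : Function.Injective f
  lt : s < t
  fst_mem : τ ∈ Ioo (0 : ℝ) 1
  snd_mem : κ ∈ Ioo (0 : ℝ) 1
  apply_start : f s = p τ
  apply_end : f t = q κ
  mem_iff : ∀ r, f r ∈ C ↔ r ∈ Ioo s t
  eq_or_eq : ∀ r, f r ∈ p '' Icc 0 1 ∪ q '' Icc 0 1 → r = s ∨ r = t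

namespace IsChord

variable {p q : ℝ → ℝ × ℝ} {C : Set (ℝ × ℝ)} {f f' k : ℝ → ℝ × ℝ}
  {s t τ κ s' t' τ' κ' a b c d : ℝ} {α β : ℝ}

theorem image_subset (hf : IsChord p q C f s t τ κ) (hα : α < t) :
    f '' Icc s α ⊆ C ∪ {p τ} := by
  rintro _ ⟨x, hx, rfl⟩
  rcases hx.1.eq_or_lt with rfl | h
  · exact Or.inr hf.apply_start
  · exact Or.inl ((hf.mem_iff x).2 ⟨h, hx.2.trans_lt hα⟩)

/-- The union of the initial segments of two chords up to a common point. -/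
theorem eventually_not_outside (h : IsBigon p q C) (hf : IsChord p q C f s t τ κ)
    (hf' : IsChord p q C f' s' t' τ' κ') (hα : α ∈ Ioo s t) (hβ : β ∈ Ioo s' t')
    (hv : f α = f' β) {r : ℝ} (hr : r ∈ uIoo τ τ') :
    ∀ᶠ x in nhds (p r), x ∈ C → ¬ Outside (f '' Icc s α ∪ f' '' Icc s' β ∪ p '' uIcc τ τ') x := by
  have hX : IsCompact (f '' Icc s α ∪ f' '' Icc s' β) :=
    (isCompact_Icc.image hf.continuous).union (isCompact_Icc.image hf'.continuous)
  have hXc : IsPreconnected (f '' Icc s α ∪ f' '' Icc s' β) :=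
    IsPreconnected.union (f α) ⟨α, right_mem_Icc.2 hα.1.le, rfl⟩
      ⟨β, right_mem_Icc.2 hβ.1.le, hv.symm⟩
      (isPreconnected_Icc.image _ hf.continuous.continuousOn)
      (isPreconnected_Icc.image _ hf'.continuous.continuousOn)
  have h1 : p τ ∈ f '' Icc s α ∪ f' '' Icc s' β :=
    Or.inl ⟨s, left_mem_Icc.2 hα.1.le, hf.apply_start⟩
  have h2 : p τ' ∈ f '' Icc s α ∪ f' '' Icc s' β :=
    Or.inr ⟨s', left_mem_Icc.2 hβ.1.le, hf'.apply_start⟩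
  have hXC : f '' Icc s α ∪ f' '' Icc s' β ⊆ C ∪ {p τ, p τ'} := by
    refine union_subset ((hf.image_subset hα.2).trans (union_subset_union_right _ ?_))
      ((hf'.image_subset hβ.2).trans (union_subset_union_right _ ?_)) <;> simp
  rcases le_total τ τ' with hle | hle
  · rw [uIcc_of_le hle]
    rw [uIoo_of_le hle] at hr
    exact h.eventually_not_outside hX hXc hXC h1 h2 hf.fst_mem.1.le hr.1 hr.2 hf'.fst_mem.2.le
  · rw [uIcc_of_ge hle]
    rw [uIoo_of_ge hle] at hr
    exact h.eventually_not_outside hX hXc (pair_comm (p τ) _ ▸ hXC) h2 h1 hf'.fst_mem.1.le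
      hr.1 hr.2 hf.fst_mem.2.le

end IsChord

theorem IsLocalCross.exists_nhds {S T : Set (ℝ × ℝ)} {x : ℝ × ℝ} (h : IsLocalCross S T x)
    {N : Set (ℝ × ℝ)} (hN : N ∈ nhds x) :
    ∃ M ⊆ N, IsOpen M ∧ x ∈ M ∧ M ⊆ closure (M \ S) ∧ ∀ y ∈ M \ S, ∃ H ⊆ M \ S,
      IsPreconnected H ∧ y ∈ H ∧ (H ∩ T).Nonempty := by
  obtain ⟨V, hV, hx, h, h0, hS, hT⟩ := h
  have he : Topology.IsOpenEmbedding (fun q : ℝ × ℝ => (h.symm q : ℝ × ℝ)) :=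
    hV.isOpenEmbedding_subtypeVal.comp h.symm.isOpenEmbedding
  set e := fun q : ℝ × ℝ => (h.symm q : ℝ × ℝ)
  have he0 : e 0 = x := by simp only [e, ← h0, Homeomorph.symm_apply_apply]
  obtain ⟨ε, hε, hball⟩ := Metric.mem_nhds_iff.1
    (he.continuous.continuousAt.preimage_mem_nhds (he0.symm ▸ hN))
  have hSd : ∀ q, e q ∈ S ↔ q.2 = 0 := fun q => Set.ext_iff.1 hS q
  have hTd : ∀ q, e q ∈ T ↔ q.1 = 0 := fun q => Set.ext_iff.1 hT q
  refine ⟨e '' Metric.ball 0 ε, image_subset_iff.2 hball, he.isOpenMap _ Metric.isOpen_ball,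
    ⟨0, Metric.mem_ball_self hε, he0⟩, ?_, ?_⟩
  · rintro _ ⟨q, hq, rfl⟩
    have hd : Dense {q : ℝ × ℝ | q.2 ≠ 0} := (dense_compl_singleton (0 : ℝ)).preimage isOpenMap_snd
    have hq' := hd.open_subset_closure_inter (Metric.isOpen_ball (x := (0 : ℝ × ℝ)) (ε := ε)) hq
    refine closure_mono ?_ (image_closure_subset_closure_image he.continuous ⟨q, hq', rfl⟩)
    rintro _ ⟨q', hq', rfl⟩
    exact ⟨⟨q', hq'.1, rfl⟩, fun h => hq'.2 ((hSd q').1 h)⟩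
  · rintro _ ⟨⟨q, hq, rfl⟩, hqS⟩
    rw [hSd] at hqS
    have key : ∀ D : Set ℝ, Convex ℝ D → (∀ d ∈ D, d ≠ 0) → q.2 ∈ D →
        ∀ d ∈ D, |d| < ε → ∃ H ⊆ e '' Metric.ball 0 ε \ S,
          IsPreconnected H ∧ e q ∈ H ∧ (H ∩ T).Nonempty := by
      intro D hD hD0 hqD d hd hdε
      refine ⟨e '' (Metric.ball 0 ε ∩ Prod.snd ⁻¹' D), ?_, ?_, ⟨q, ⟨hq, hqD⟩, rfl⟩,
        e (0, d), ⟨(0, d), ⟨?_, hd⟩, rfl⟩, (hTd _).2 rfl⟩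
      · rintro _ ⟨q', hq', rfl⟩
        exact ⟨⟨q', hq'.1, rfl⟩, fun h => hD0 _ hq'.2 ((hSd q').1 h)⟩
      · refine IsPreconnected.image (Convex.isPreconnected ?_) _ he.continuous.continuousOn
        exact (convex_ball _ _).inter (hD.linear_preimage (LinearMap.snd ℝ ℝ ℝ))
      · rw [mem_ball_zero_iff, Prod.norm_def]
        simpa using hdε
    rcases lt_or_gt_of_ne hqS with h | h
    · exact key (Iio 0) (convex_Iio 0) (fun _ hd => hd.ne) h (-(ε / 2))
        (by simpa using hε) (by rw [abs_neg, abs_of_pos] <;> linarith)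
    · exact key (Ioi 0) (convex_Ioi 0) (fun _ hd => hd.ne') h (ε / 2)
        (by simpa using hε) (by rw [abs_of_pos] <;> linarith)

namespace IsChord

variable {p q : ℝ → ℝ × ℝ} {C : Set (ℝ × ℝ)} {f f' k : ℝ → ℝ × ℝ}
  {s t τ κ s' t' τ' κ' a b c d : ℝ} {α β ξ x : ℝ}

theorem eq_start (h : IsBigon p q C) (hf : IsChord p q C f s t τ κ) {r : ℝ}
    (hr : f r ∈ p '' Icc 0 1) : r = s := by
  refine (hf.eq_or_eq r (Or.inl hr)).resolve_right ?_
  rintro rfl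
  obtain ⟨u, hu, hur⟩ := hr
  rcases h.meet_snd hu (Ioo_subset_Icc_self hf.snd_mem) (hur.trans hf.apply_end) with h0 | h0
  exacts [hf.snd_mem.1.ne' h0, hf.snd_mem.2.ne h0]

theorem uIcc_subset (hf : IsChord p q C f s t τ κ) (hf' : IsChord p q C f' s' t' τ' κ') :
    uIcc τ τ' ⊆ Icc 0 1 :=
  uIcc_subset_Icc (Ioo_subset_Icc_self hf.fst_mem) (Ioo_subset_Icc_self hf'.fst_mem)

theorem isCompact_theta (h : IsBigon p q C) (hf : IsChord p q C f s t τ κ)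
    (hf' : IsChord p q C f' s' t' τ' κ') :
    IsCompact (f '' Icc s α ∪ f' '' Icc s' β ∪ p '' uIcc τ τ') :=
  ((isCompact_Icc.image hf.continuous).union (isCompact_Icc.image hf'.continuous)).union
    (h.isCompact_fst _ _)

theorem theta_subset (hf : IsChord p q C f s t τ κ)
    (hf' : IsChord p q C f' s' t' τ' κ') (hα : α ∈ Ioo s t) (hβ : β ∈ Ioo s' t') :
    f '' Icc s α ∪ f' '' Icc s' β ∪ p '' uIcc τ τ' ⊆ C ∪ (p '' Icc 0 1 ∪ q '' Icc 0 1) := by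
  refine union_subset (union_subset ((hf.image_subset hα.2).trans ?_)
    ((hf'.image_subset hβ.2).trans ?_)) ?_
  · refine union_subset_union_right _ (singleton_subset_iff.2 (Or.inl ?_))
    exact mem_image_of_mem p (Ioo_subset_Icc_self hf.fst_mem)
  · refine union_subset_union_right _ (singleton_subset_iff.2 (Or.inl ?_))
    exact mem_image_of_mem p (Ioo_subset_Icc_self hf'.fst_mem)
  · exact (image_mono (hf.uIcc_subset hf')).trans
      (subset_union_left.trans subset_union_right)

theorem mem_uIcc_of_mem_theta (hf : IsChord p q C f s t τ κ)
    (hf' : IsChord p q C f' s' t' τ' κ') (hα : α ∈ Ioo s t) (hβ : β ∈ Ioo s' t') {y : ℝ × ℝ}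
    (hy : y ∈ f '' Icc s α ∪ f' '' Icc s' β ∪ p '' uIcc τ τ') (hyC : y ∉ C) :
    y ∈ p '' uIcc τ τ' := by
  rcases hy with (hy | hy) | hy
  · rw [((hf.image_subset hα.2) hy).resolve_left hyC]
    exact mem_image_of_mem p left_mem_uIcc
  · rw [((hf'.image_subset hβ.2) hy).resolve_left hyC]
    exact mem_image_of_mem p right_mem_uIcc
  · exact hy

theorem end_outside (h : IsBigon p q C) (hf : IsChord p q C f s t τ κ)
    (hf' : IsChord p q C f' s' t' τ' κ') (hα : α ∈ Ioo s t) (hβ : β ∈ Ioo s' t')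
    (hk : IsChord p q C k a b c d) :
    k b ∉ f '' Icc s α ∪ f' '' Icc s' β ∪ p '' uIcc τ τ' ∧
      Outside (f '' Icc s α ∪ f' '' Icc s' β ∪ p '' uIcc τ τ') (k b) := by
  have hn : k b ∉ f '' Icc s α ∪ f' '' Icc s' β ∪ p '' uIcc τ τ' := fun hy =>
    hk.lt.ne' (hk.eq_start h (image_mono (hf.uIcc_subset hf') (mem_uIcc_of_mem_theta hf hf' hα hβ
      hy fun hC => lt_irrefl _ ((hk.mem_iff b).1 hC).2)))
  refine ⟨hn, h.outside (isCompact_theta h hf hf') (theta_subset hf hf' hα hβ) ?_ hn⟩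
  rw [hk.apply_end]
  exact h.arcLike_snd hk.snd_mem

/-- A chord starting between two crossing chords leaves the triangle they form with `p`. -/
theorem exists_crossing_of_between (h : IsBigon p q C) (hf : IsChord p q C f s t τ κ)
    (hf' : IsChord p q C f' s' t' τ' κ') (hk : IsChord p q C k a b c d) (hα : α ∈ Ioo s t)
    (hβ : β ∈ Ioo s' t') (hv : f α = f' β) (hc : c ∈ uIoo τ τ') :
    ∃ r ∈ Ioo a b, k r ∈ f '' Icc s α ∪ f' '' Icc s' β := by
  by_contra! hno
  have hend := end_outside h hf hf' hα hβ hk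
  have hd : Disjoint (k '' Ioc a b) (f '' Icc s α ∪ f' '' Icc s' β ∪ p '' uIcc τ τ') := by
    refine disjoint_left.2 ?_
    rintro _ ⟨r, hr, rfl⟩ hrΓ
    rcases hr.2.eq_or_lt with rfl | hrb
    · exact hend.1 hrΓ
    · rcases hrΓ with hr' | hr'
      · exact hno r ⟨hr.1, hrb⟩ hr'
      · exact hr.1.ne' (hk.eq_start h (image_mono (hf.uIcc_subset hf') hr'))
  have hev := eventually_not_outside h hf hf' hα hβ hv hc
  rw [← hk.apply_start] at hev
  obtain ⟨r, hr, hr'⟩ := ((hk.continuous.continuousAt.eventually hev).filter_mono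
    (nhdsWithin_le_nhds (s := Ioi a)) |>.and (Ioo_mem_nhdsGT hk.lt)).exists
  refine hr ((hk.mem_iff r).2 hr') (Outside.of_isPreconnected (isCompact_theta h hf hf').isClosed
    (isPreconnected_Ioc.image _ hk.continuous.continuousOn) hd
    ⟨b, right_mem_Ioc.2 hk.lt, rfl⟩ ⟨r, ⟨hr'.1, hr'.2.le⟩, rfl⟩ hend.2)

theorem exists_not_outside_theta (h : IsBigon p q C) (hf : IsChord p q C f s t τ κ)
    (hf' : IsChord p q C f' s' t' τ' κ') (hα : α ∈ Ioo s t) (hβ : β ∈ Ioo s' t')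
    (hv : f α = f' β) (hne : τ ≠ τ') :
    ∃ x, x ∉ f '' Icc s α ∪ f' '' Icc s' β ∪ p '' uIcc τ τ' ∧
      ¬ Outside (f '' Icc s α ∪ f' '' Icc s' β ∪ p '' uIcc τ τ') x := by
  obtain ⟨r, hr⟩ : (uIoo τ τ').Nonempty := nonempty_Ioo.2 (inf_lt_sup.2 hne)
  have hrI : r ∈ Ioo (0 : ℝ) 1 :=
    ⟨(lt_min hf.fst_mem.1 hf'.fst_mem.1).trans hr.1, hr.2.trans (max_lt hf.fst_mem.2 hf'.fst_mem.2)⟩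
  have hpr := h.fst_notMem (Ioo_subset_Icc_self hrI)
  have hX : p r ∉ f '' Icc s α ∪ f' '' Icc s' β := by
    have hinj := fun u hu => h.injOn_fst (Ioo_subset_Icc_self hrI) (x₂ := u)
      (Ioo_subset_Icc_self hu)
    rintro (hy | hy)
    · have := hinj _ hf.fst_mem (((hf.image_subset hα.2) hy).resolve_left hpr)
      subst this
      exact left_notMem_uIoo hr
    · have := hinj _ hf'.fst_mem (((hf'.image_subset hβ.2) hy).resolve_left hpr)
      subst this
      exact right_notMem_uIoo hr
  have hXc : IsClosed (f '' Icc s α ∪ f' '' Icc s' β) :=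
    ((isCompact_Icc.image hf.continuous).union (isCompact_Icc.image hf'.continuous)).isClosed
  obtain ⟨x, hx, hxC⟩ := mem_closure_iff_nhds.1 (h.fst_mem_closure hrI) _
    (Filter.inter_mem (eventually_not_outside h hf hf' hα hβ hv hr) (hXc.isOpen_compl.mem_nhds hX))
  refine ⟨x, ?_, hx.1 hxC⟩
  rintro (hx' | hx')
  · exact hx.2 hx'
  · exact disjoint_left.1 h.disjoint hxC (Or.inl (image_mono (hf.uIcc_subset hf') hx'))

theorem arcLike_theta (h : IsBigon p q C) (hf : IsChord p q C f s t τ κ)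
    (hf' : IsChord p q C f' s' t' τ' κ') (hff' : (range f ∩ range f').Subsingleton)
    (hβ : β ∈ Ioo s' t') (hv : f α = f' β) (hx : x ∈ Ioo s α) :
    ArcLike (f '' Icc s α ∪ f' '' Icc s' β ∪ p '' uIcc τ τ') (f x) := by
  have hp := h.injOn_fst.mono (hf.uIcc_subset hf')
  have hcf : IsCompact (f' '' Icc s' β) := isCompact_Icc.image hf'.continuous
  have hcp : IsCompact (p '' uIcc τ τ') := h.isCompact_fst _ _
  have hcap : f' '' Icc s' β ∩ p '' uIcc τ τ' = {p τ'} := by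
    refine Subset.antisymm ?_ (singleton_subset_iff.2
      ⟨⟨s', left_mem_Icc.2 hβ.1.le, hf'.apply_start⟩, mem_image_of_mem p right_mem_uIcc⟩)
    rintro _ ⟨⟨y, hy, rfl⟩, hy'⟩
    rw [hf'.eq_start h (image_mono (hf.uIcc_subset hf') hy')]
    exact hf'.apply_start
  rw [union_assoc]
  refine arcLike_of_loop hf.continuous.continuousOn hf.injective.injOn (hcf.union hcp)
    (LogTrivial.union hcf.isClosed hcp.isClosed (hcap ▸ isPreconnected_singleton)
      ((logTrivial_Icc _ _).image isCompact_Icc hf'.continuous.continuousOn hf'.injective.injOn)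
      ((logTrivial_Icc _ _).image isCompact_Icc h.continuous_fst.continuousOn hp)) ?_
    (Or.inr ?_) (Or.inl ⟨β, right_mem_Icc.2 hβ.1.le, hv.symm⟩) hx.1 hx.2
  · rintro y hy (⟨z, hz, hzy⟩ | hy')
    · exact Or.inr (hf.injective (hff' ⟨⟨y, rfl⟩, z, hzy⟩ ⟨⟨α, rfl⟩, β, hv.symm⟩))
    · exact Or.inl (hf.eq_start h (image_mono (hf.uIcc_subset hf') hy'))
  · rw [hf.apply_start]
    exact mem_image_of_mem p left_mem_uIcc

/-- A chord starting outside the triangle formed by two crossing chords and `p` and entering it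
through one of the chords leaves it through the other one. -/
theorem exists_crossing_of_notMem (h : IsBigon p q C) (hf : IsChord p q C f s t τ κ)
    (hf' : IsChord p q C f' s' t' τ' κ') (hk : IsChord p q C k a b c d)
    (hff' : (range f ∩ range f').Subsingleton) (hfk : (range f ∩ range k).Subsingleton)
    (hcr : IsLocalCross (range f) (range k) (f x)) (hne : τ ≠ τ') (hα : α ∈ Ioo s t)
    (hβ : β ∈ Ioo s' t') (hv : f α = f' β) (hc : c ∉ uIcc τ τ') (hx : x ∈ Ioo s α)
    (hξ : k ξ = f x) :
    ∃ r ∈ Ioo a b, k r ∈ f' '' Ioo s' β := by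
  by_contra! hno
  set Γ := f '' Icc s α ∪ f' '' Icc s' β ∪ p '' uIcc τ τ' with hΓ
  have hΓc : IsCompact Γ := isCompact_theta h hf hf'
  have hend := end_outside h hf hf' hα hβ hk
  have hxC : f x ∈ C := (hf.mem_iff x).2 ⟨hx.1, hx.2.trans hα.2⟩
  have hξI : ξ ∈ Ioo a b := (hk.mem_iff ξ).1 (hξ ▸ hxC)
  have hmeet : ∀ r y, k r = f y → r = ξ ∧ y = x := fun r y hr => by
    have := hfk ⟨⟨y, rfl⟩, r, hr⟩ ⟨⟨x, rfl⟩, ξ, hξ⟩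
    exact ⟨hk.injective (hr.trans (this.trans hξ.symm)), hf.injective this⟩
  have hkf' : ∀ r ∈ Ioo a b, k r ∉ f' '' Icc s' β := by
    rintro r hr ⟨y, hy, hyr⟩
    rcases hy.1.eq_or_lt with rfl | h1
    · exact lt_irrefl _ ((hf'.mem_iff _).1 (hyr ▸ (hk.mem_iff r).2 hr)).1
    · rcases hy.2.eq_or_lt with rfl | h2
      · exact hx.2.ne' (hmeet r α (hyr.symm.trans hv.symm)).2
      · exact hno r hr ⟨y, ⟨h1, h2⟩, hyr⟩
  have hstart : k a ∉ Γ := fun hy => by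
    have h1 := mem_uIcc_of_mem_theta hf hf' hα hβ hy fun hC =>
      lt_irrefl _ ((hk.mem_iff a).1 hC).1
    rw [hk.apply_start] at h1
    obtain ⟨u, hu, huc⟩ := h1
    exact hc (h.injOn_fst (hf.uIcc_subset hf' hu) (Ioo_subset_Icc_self hk.fst_mem) huc ▸ hu)
  have hkΓ : ∀ r ∈ Icc a b, r ≠ ξ → k r ∉ Γ := by
    intro r hr hrξ hrΓ
    rcases hr.1.eq_or_lt with rfl | h1
    · exact hstart hrΓ
    rcases hr.2.eq_or_lt with rfl | h2
    · exact hend.1 hrΓ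
    rcases hrΓ with (⟨y, hy, hyr⟩ | hrΓ) | hrΓ
    · exact hrξ (hmeet r y hyr.symm).1
    · exact hkf' r ⟨h1, h2⟩ hrΓ
    · exact h1.ne' (hk.eq_start h (image_mono (hf.uIcc_subset hf') hrΓ))
  have hstart' : Outside Γ (k a) := by
    refine h.outside hΓc (theta_subset hf hf' hα hβ) ?_ hstart
    rw [hk.apply_start]
    exact h.arcLike_fst hk.fst_mem
  have hkO : ∀ r ∈ Icc a b, r ≠ ξ → Outside Γ (k r) := by
    intro r hr hrξ
    rcases lt_or_gt_of_ne hrξ with h1 | h1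
    · refine Outside.of_isPreconnected hΓc.isClosed (T := k '' Ico a ξ)
        (isPreconnected_Ico.image _ hk.continuous.continuousOn) ?_ ⟨a, ⟨le_rfl, hξI.1⟩, rfl⟩
        ⟨r, ⟨hr.1, h1⟩, rfl⟩ hstart'
      refine disjoint_left.2 ?_
      rintro _ ⟨y, hy, rfl⟩
      exact hkΓ y ⟨hy.1, hy.2.le.trans hξI.2.le⟩ hy.2.ne
    · refine Outside.of_isPreconnected hΓc.isClosed (T := k '' Ioc ξ b)
        (isPreconnected_Ioc.image _ hk.continuous.continuousOn) ?_ ⟨b, ⟨hξI.2, le_rfl⟩, rfl⟩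
        ⟨r, ⟨h1, hr.2⟩, rfl⟩ hend.2
      refine disjoint_left.2 ?_
      rintro _ ⟨y, hy, rfl⟩
      exact hkΓ y ⟨hξI.1.le.trans hy.1.le, hy.2⟩ hy.1.ne'
  have hN : C \ (f' '' Icc s' β) ∈ nhds (f x) := by
    refine (h.isOpen.sdiff (isCompact_Icc.image hf'.continuous).isClosed).mem_nhds ⟨hxC, ?_⟩
    exact hξ ▸ hkf' ξ hξI
  obtain ⟨M, hMN, hMo, hxM, hMcl, hM⟩ := hcr.exists_nhds hN
  have hMΓ : ∀ y ∈ M \ range f, y ∉ Γ := by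
    rintro y ⟨hyM, hyf⟩ ((⟨z, hz, rfl⟩ | hy) | hy)
    · exact hyf ⟨z, rfl⟩
    · exact (hMN hyM).2 hy
    · exact disjoint_left.1 h.disjoint (hMN hyM).1 (Or.inl (image_mono (hf.uIcc_subset hf') hy))
  have hMO : ∀ y ∈ M \ range f, Outside Γ y := by
    intro y hy
    obtain ⟨H, hHM, hH, hyH, _, hzH, r, rfl⟩ := hM y hy
    refine Outside.of_isPreconnected hΓc.isClosed hH
      (disjoint_left.2 fun w hw => hMΓ w (hHM hw)) hzH hyH (hkO r ?_ ?_)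
    · exact Ioo_subset_Icc_self ((hk.mem_iff r).1 (hMN (hHM hzH).1).1)
    · rintro rfl
      exact (hHM hzH).2 ⟨x, hξ.symm⟩
  obtain ⟨w, hw, hwO⟩ := exists_not_outside_theta h hf hf' hα hβ hv hne
  have hopen := isOpen_inside hΓc.isClosed
  have hfr : frontier {w | w ∉ Γ ∧ ¬ Outside Γ w} ⊆ Γ := fun y hy => by
    by_contra hyΓ
    exact hy.2 (hopen.interior_eq.symm ▸
      ⟨hyΓ, mem_of_mem_closure_inside hΓc.isClosed hy.1 hyΓ⟩)
  have hcl := (arcLike_theta h hf hf' hff' hβ hv hx).mem_closure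
    (isBounded_inside hΓc.isBounded) ⟨w, hw, hwO⟩ hfr (disjoint_left.2 fun y hy => hy.1)
  obtain ⟨y, hyM, hy⟩ := mem_closure_iff.1 hcl M hMo hxM
  obtain ⟨u, ⟨huM, hu⟩, hu'⟩ := mem_closure_iff.1 (hMcl hyM) _ (hMo.inter hopen) ⟨hyM, hy⟩
  exact hu.2 (hMO u hu')

end IsChord

/-- The curve `k` meets the curve `i` strictly before the point `v` of `i`, where `inc i` is the set
of points of `i` and `g i` the parameter along `i`. -/
def MeetsBefore {ι X : Type*} (inc : ι → Set X) (g : ι → X → ℝ) (i k : ι) (v : X) : Prop :=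
  ∃ x ∈ inc i ∩ inc k, g i x < g i v

/-- The order properties of a family of curves starting at the points `τ i` of a line and pairwise
meeting at most once. -/
structure IsCrossingSystem {ι X : Type*} (inc : ι → Set X) (g : ι → X → ℝ) (τ : ι → ℝ) :
    Prop where
  injective : Function.Injective τ
  injOn : ∀ i, InjOn (g i) (inc i)
  inter : ∀ i j, i ≠ j → (inc i ∩ inc j).Subsingleton
  between : ∀ i j k v, v ∈ inc i → v ∈ inc j → τ k ∈ Ioo (τ i) (τ j) → v ∉ inc k →
    MeetsBefore inc g i k v ∨ MeetsBefore inc g j k v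
  outside : ∀ i j k v, i ≠ j → v ∈ inc i → v ∈ inc j → τ k ∉ uIcc (τ i) (τ j) →
    MeetsBefore inc g i k v → MeetsBefore inc g j k v

namespace IsCrossingSystem

variable {ι X : Type*} {inc : ι → Set X} {g : ι → X → ℝ} {τ : ι → ℝ}

theorem notMem (h : IsCrossingSystem inc g τ) {i k : ι} {v : X} (hik : i ≠ k) (hv : v ∈ inc i)
    (hm : MeetsBefore inc g i k v) : v ∉ inc k := by
  obtain ⟨x, hx, hlt⟩ := hm
  intro hvk
  rw [h.inter i k hik hx ⟨hv, hvk⟩] at hlt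
  exact lt_irrefl _ hlt

theorem not_meetsBefore_and (h : IsCrossingSystem inc g τ) {i j k : ι} {v : X} (hvi : v ∈ inc i)
    (hvj : v ∈ inc j) (hk : τ k ∈ Ioo (τ i) (τ j)) (h1 : MeetsBefore inc g i k v)
    (h2 : MeetsBefore inc g j k v) : False := by
  have hki : k ≠ i := fun h => hk.1.ne (h ▸ rfl)
  have hkj : k ≠ j := fun h => hk.2.ne (h ▸ rfl)
  have hij : i ≠ j := fun h => (hk.1.trans hk.2).ne (h ▸ rfl)
  obtain ⟨x, ⟨hxi, hxk⟩, hx⟩ := h1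
  obtain ⟨y, ⟨hyj, hyk⟩, hy⟩ := h2
  rcases lt_trichotomy (g k x) (g k y) with hxy | hxy | hxy
  · obtain ⟨z, ⟨hzj, hzi⟩, hz⟩ := h.outside k j i y hkj hyk hyj
      (by rw [uIcc_of_le hk.2.le]; exact fun h' => h'.1.not_gt hk.1) ⟨x, ⟨hxk, hxi⟩, hxy⟩
    rw [h.inter i j hij ⟨hzi, hzj⟩ ⟨hvi, hvj⟩] at hz
    exact lt_asymm hz hy
  · rw [← h.injOn k hxk hyk hxy] at hyj
    rw [h.inter i j hij ⟨hxi, hyj⟩ ⟨hvi, hvj⟩] at hx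
    exact lt_irrefl _ hx
  · obtain ⟨z, ⟨hzi, hzj⟩, hz⟩ := h.outside k i j x hki hxk hxi
      (by rw [uIcc_of_ge hk.1.le]; exact fun h' => h'.2.not_gt hk.2) ⟨y, ⟨hyk, hyj⟩, hxy⟩
    rw [h.inter i j hij ⟨hzi, hzj⟩ ⟨hvi, hvj⟩] at hz
    exact lt_asymm hz hx

theorem exists_first [Finite ι] (h : IsCrossingSystem inc g τ) {i k : ι} {u : X} (hik : i ≠ k)
    (hu : u ∈ inc i) (huk : u ∈ inc k) :
    ∃ v ∈ inc i, (∃ j ≠ i, v ∈ inc j) ∧ ∀ m ≠ i, ¬ MeetsBefore inc g i m v := by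
  have hfin : (⋃ j ∈ {j | j ≠ i}, inc i ∩ inc j).Finite :=
    (toFinite _).biUnion fun j hj => (h.inter i j (Ne.symm hj)).finite
  obtain ⟨v, hv, hmin⟩ := exists_min_image _ (g i) hfin
    ⟨u, mem_biUnion (show k ≠ i from hik.symm) ⟨hu, huk⟩⟩
  obtain ⟨j, hj, hvi, hvj⟩ := mem_iUnion₂.1 hv
  refine ⟨v, hvi, ⟨j, hj, hvj⟩, ?_⟩
  rintro m hm ⟨x, hx, hlt⟩
  exact hlt.not_ge (hmin x (mem_biUnion (show m ≠ i from hm) hx))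

/-- `v` is the first vertex of `i`, and `i` and `j` are the extreme curves through `v`. -/
def IsExtremePair (inc : ι → Set X) (g : ι → X → ℝ) (τ : ι → ℝ) (i j : ι) (v : X) : Prop :=
  i ≠ j ∧ v ∈ inc i ∧ v ∈ inc j ∧ (∀ m ≠ i, ¬ MeetsBefore inc g i m v) ∧
    ∀ m, v ∈ inc m → τ m ∈ Icc (τ i) (τ j)

theorem exists_isExtremePair [Finite ι] (h : IsCrossingSystem inc g τ) {i j : ι} {v : X}
    (hv : v ∈ inc i) (hj : j ≠ i) (hvj : v ∈ inc j) (hF : ∀ m ≠ i, ¬ MeetsBefore inc g i m v)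
    (hmin : ∀ m, v ∈ inc m → τ i ≤ τ m) : ∃ M, IsExtremePair inc g τ i M v := by
  obtain ⟨M, hM, hmax⟩ := exists_max_image {m | v ∈ inc m} τ (toFinite _) ⟨i, hv⟩
  refine ⟨M, ?_, hv, hM, hF, fun m hm => ⟨hmin m hm, hmax m hm⟩⟩
  rintro rfl
  exact hj (h.injective (le_antisymm (hmax j hvj) (hmin j hvj)))

theorem exists_slidable [Finite ι] (h : IsCrossingSystem inc g τ)
    (hex : ∃ v i j, i ≠ j ∧ v ∈ inc i ∧ v ∈ inc j) :
    ∃ v, (∃ i j, i ≠ j ∧ v ∈ inc i ∧ v ∈ inc j) ∧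
      ∀ m, v ∈ inc m → ∀ k ≠ m, ¬ MeetsBefore inc g m k v := by
  have hpair : {ij : ι × ι | ∃ v, IsExtremePair inc g τ ij.1 ij.2 v}.Nonempty := by
    obtain ⟨v₀, i₀, j₀, hij₀, hi₀, hj₀⟩ := hex
    obtain ⟨i, ⟨u, j, hij, hui, huj⟩, hmin⟩ := exists_min_image
      {i | ∃ v j, i ≠ j ∧ v ∈ inc i ∧ v ∈ inc j} τ (toFinite _) ⟨i₀, v₀, j₀, hij₀, hi₀, hj₀⟩
    obtain ⟨v, hv, ⟨j, hj, hvj⟩, hF⟩ := h.exists_first hij hui huj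
    obtain ⟨M, hM⟩ := h.exists_isExtremePair hv hj hvj hF fun m hm => by
      rcases eq_or_ne m i with rfl | hmi
      · exact le_rfl
      · exact hmin m ⟨v, i, hmi, hm, hv⟩
    exact ⟨(i, M), v, hM⟩
  obtain ⟨⟨i, j⟩, ⟨v, hij, hvi, hvj, hF, hext⟩, hshort⟩ := exists_min_image _
    (fun ij : ι × ι => τ ij.2 - τ ij.1) (toFinite _) hpair
  dsimp only at hij hvi hvj hF hext hshort
  have hτ : τ i ≤ τ j := (hext i hvi).2
  have hout : ∀ m, τ m ∉ Icc (τ i) (τ j) → ¬ MeetsBefore inc g j m v := fun m hm hb =>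
    hF m (by rintro rfl; exact hm ⟨le_rfl, hτ⟩)
      (h.outside j i m v hij.symm hvj hvi (by rwa [uIcc_of_ge hτ]) hb)
  rcases {k | τ k ∈ Ioo (τ i) (τ j) ∧ MeetsBefore inc g j k v}.eq_empty_or_nonempty with hK | hK
  · refine ⟨v, ⟨i, j, hij, hvi, hvj⟩, fun m hm k hkm hb => ?_⟩
    have hvk := h.notMem hkm.symm hm hb
    have hki : k ≠ i := by rintro rfl; exact hvk hvi
    rcases eq_or_ne m i with rfl | hmi
    · exact hF k hkm hb
    by_cases hk : τ k ∈ uIcc (τ m) (τ i)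
    · rw [uIcc_of_ge (hext m hm).1] at hk
      have hk' : τ k ∈ Ioo (τ i) (τ j) :=
        ⟨hk.1.lt_of_ne fun h' => hki (h.injective h').symm,
          (hk.2.lt_of_ne fun h' => hkm (h.injective h')).trans_le (hext m hm).2⟩
      rcases h.between i j k v hvi hvj hk' hvk with h1 | h1
      · exact hF k hki h1
      · exact (Set.ext_iff.1 hK k).1 ⟨hk', h1⟩
    · exact hF k hki (h.outside m i k v hmi hm hvi hk hb)
  exfalso
  obtain ⟨k, ⟨hk, hkj⟩, hkmin⟩ := exists_min_image _ τ (toFinite _) hK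
  have hjk : j ≠ k := fun h' => hk.2.ne (h' ▸ rfl)
  have hik : i ≠ k := fun h' => hk.1.ne (h' ▸ rfl)
  have hvk : v ∉ inc k := h.notMem hjk hvj hkj
  obtain ⟨u, ⟨huj, huk⟩, huv⟩ := id hkj
  obtain ⟨w, hwk, ⟨n, hnk, hwn⟩, hwF⟩ := h.exists_first hjk.symm huk huj
  have hwu : g k w ≤ g k u := not_lt.1 fun h' => hwF j hjk ⟨u, ⟨huk, huj⟩, h'⟩
  have hin : ∀ m, w ∈ inc m → τ m ∈ Icc (τ i) (τ j) := by
    intro m hwm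
    by_contra hm
    rcases hwu.lt_or_eq with hlt | heq
    · obtain ⟨y, hy, hyu⟩ := h.outside k j m u hjk.symm huk huj
        (fun h' => hm (uIcc_subset_Icc (Ioo_subset_Icc_self hk) (right_mem_Icc.2 hτ) h'))
        ⟨w, ⟨hwk, hwm⟩, hlt⟩
      exact hout m hm ⟨y, hy, hyu.trans huv⟩
    · rw [h.injOn k hwk huk heq] at hwm
      exact hout m hm ⟨u, ⟨huj, hwm⟩, huv⟩
  have hthru : ∀ m, m ≠ k → w ∈ inc m → τ m < τ k → v ∈ inc m → ¬ MeetsBefore inc g m k v →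
      False := by
    intro m hmk hwm hlt hvm hnb
    have hle : g m v ≤ g m w := not_lt.1 fun h' => hnb ⟨w, ⟨hwm, hwk⟩, h'⟩
    have hlt' : g m v < g m w := hle.lt_of_ne fun h' => hvk (h.injOn m hvm hwm h' ▸ hwk)
    exact hwF j hjk (h.outside m k j w hmk hwm hwk
      (by rw [uIcc_of_le hlt.le]; exact fun h' => h'.2.not_gt hk.2) ⟨v, ⟨hvm, hvj⟩, hlt'⟩)
  have hmin : ∀ m, w ∈ inc m → τ k ≤ τ m := by
    intro m hwm
    by_contra! hlt
    have hmk : m ≠ k := fun h' => hlt.ne (h' ▸ rfl)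
    rcases eq_or_ne m i with rfl | hmi
    · exact hthru m hmk hwm hlt hvi (hF k hmk.symm)
    have hm : τ m ∈ Ioo (τ i) (τ j) :=
      ⟨(hin m hwm).1.lt_of_ne fun h' => hmi (h.injective h').symm, hlt.trans hk.2⟩
    have hvm : v ∈ inc m := by
      by_contra hvm
      rcases h.between i j m v hvi hvj hm hvm with h1 | h1
      · exact hF m hmi h1
      · exact (hkmin m ⟨hm, h1⟩).not_gt hlt
    exact hthru m hmk hwm hlt hvm fun h1 => h.not_meetsBefore_and hvm hvj ⟨hlt, hk.2⟩ h1 hkj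
  obtain ⟨M, hM⟩ := h.exists_isExtremePair hwk hnk hwn hwF hmin
  have := hshort (k, M) ⟨w, hM⟩
  dsimp only at this
  linarith [(hin M hM.2.2.1).2, hk.1]

end IsCrossingSystem

/-- Inversion of the plane at the point `y`. -/
def inversionAt (y : ℝ × ℝ) : (ℝ × ℝ) ≃ (ℝ × ℝ) where
  toFun u := toComplex.symm (toComplex u - toComplex y)⁻¹
  invFun w := toComplex.symm (toComplex y + (toComplex w)⁻¹)
  left_inv u := by simp
  right_inv w := by simp

theorem toComplex_inversionAt (y u : ℝ × ℝ) :
    toComplex (inversionAt y u) = (toComplex u - toComplex y)⁻¹ := by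
  simp [inversionAt]

theorem inversionAt_self (y : ℝ × ℝ) : inversionAt y y = 0 := by
  simp [inversionAt]

theorem continuousAt_inversionAt {y u : ℝ × ℝ} (h : u ≠ y) : ContinuousAt (inversionAt y) u :=
  toComplex.symm.continuous.continuousAt.comp
    ((toComplex.continuous.continuousAt.sub continuousAt_const).inv₀ (toComplex_sub_ne_zero h))

theorem continuousAt_inversionAt_symm {y w : ℝ × ℝ} (h : w ≠ 0) :
    ContinuousAt (inversionAt y).symm w :=
  toComplex.symm.continuous.continuousAt.comp
    (continuousAt_const.add (toComplex.continuous.continuousAt.inv₀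
      fun h' => h (toComplex.injective (h'.trans (map_zero _).symm))))

theorem inversionAt_ne_zero {y u : ℝ × ℝ} (h : u ≠ y) : inversionAt y u ≠ 0 := fun h' =>
  h ((inversionAt y).injective (h'.trans (inversionAt_self y).symm))

theorem symm_mem_closure_of_mem_closure_image {y w : ℝ × ℝ} {S : Set (ℝ × ℝ)}
    (hw : w ∈ closure (inversionAt y '' S)) (h0 : w ≠ 0) : (inversionAt y).symm w ∈ closure S :=
  (continuousAt_inversionAt_symm h0).continuousWithinAt.mem_closure hw
    (by rintro _ ⟨u, hu, rfl⟩; simpa using hu)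

theorem isClosed_insert_inversionAt {y : ℝ × ℝ} {S : Set (ℝ × ℝ)} (hS : IsClosed S) :
    IsClosed (insert 0 (inversionAt y '' S)) := by
  refine isClosed_of_closure_subset fun w hw => ?_
  rw [← union_singleton, closure_union, closure_singleton] at hw
  by_cases h0 : w = 0
  · exact Or.inl h0
  · have := symm_mem_closure_of_mem_closure_image (hw.resolve_right h0) h0
    rw [hS.closure_eq] at this
    exact Or.inr ⟨_, this, (inversionAt y).apply_symm_apply w⟩

/-- The inversion, at a point `y`, of a closed proper subset of an arc does not enclose the
image of any point off the arc. -/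
theorem outside_insert_inversionAt {f : ℝ → ℝ × ℝ} (hf : Topology.IsEmbedding f)
    {F : Set (ℝ × ℝ)} (hF : IsClosed F) (hFf : F ⊆ range f) {c : ℝ} (hc : f c ∉ F)
    {x y : ℝ × ℝ} (hx : x ∉ range f) (hy : y ∉ range f) (hxy : x ≠ y) :
    Outside (insert 0 (inversionAt y '' F)) (inversionAt y x) := by
  set δ := ‖toComplex (inversionAt y x)‖ with hδ
  have hδ0 : 0 < δ := norm_pos_iff.2 fun h' =>
    inversionAt_ne_zero hxy (toComplex.injective (h'.trans (map_zero _).symm))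
  have hfy : ∀ r, f r ≠ y := fun r hr => hy ⟨r, hr⟩
  have hFT : ∀ T : Set ℝ, IsClosed T → IsClosed (F ∩ f '' T) := fun T hT => by
    obtain ⟨Z, hZ, rfl⟩ := hf.isClosed_iff.1 hT
    have : F ∩ f '' (f ⁻¹' Z) = F ∩ Z := by
      rw [image_preimage_eq_inter_range, ← inter_assoc, inter_right_comm,
        inter_eq_self_of_subset_left hFf]
    exact this ▸ hF.inter hZ
  obtain ⟨d, hdc, hd⟩ : ∃ d, |c| < d ∧ ∀ r, f r ∈ F → d ≤ |r| →
      ‖toComplex (inversionAt y (f r))‖ < δ := by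
    set F₀ := F ∩ {u | ‖toComplex u - toComplex y‖ ≤ δ⁻¹}
    have hF₀ : IsCompact F₀ := by
      refine Metric.isCompact_of_isClosed_isBounded (hF.inter (isClosed_le
        (toComplex.continuous.sub continuous_const).norm continuous_const))
        (isBounded_of_norm_le (R := δ⁻¹ + ‖toComplex y‖) fun u hu => ?_)
      have h1 : ‖toComplex u - toComplex y‖ ≤ δ⁻¹ := hu.2
      linarith [norm_le_norm_sub_add (toComplex u) (toComplex y)]
    obtain ⟨R, hR⟩ := ((hf.isInducing.isCompact_preimage_iff
      (inter_subset_left.trans hFf)).2 hF₀).isBounded.exists_norm_le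
    refine ⟨max R |c| + 1, by linarith [le_max_right R |c|], fun r hr hdr => ?_⟩
    rw [toComplex_inversionAt, norm_inv]
    refine inv_lt_of_inv_lt₀ hδ0 (not_le.1 fun hle => ?_)
    have := hR r ⟨hr, hle⟩
    rw [Real.norm_eq_abs] at this
    linarith [le_max_left R |c|]
  obtain ⟨hdc1, hdc2⟩ := abs_lt.1 hdc
  set g := inversionAt y ∘ f with hg
  have hgc : Continuous g := continuous_iff_continuousAt.2 fun r =>
    ContinuousAt.comp (continuousAt_inversionAt (hfy r)) hf.continuous.continuousAt
  have hgi : Function.Injective g := (inversionAt y).injective.comp hf.injective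
  have hg0 : ∀ r, g r ≠ 0 := fun r => inversionAt_ne_zero (hfy r)
  have hgx : inversionAt y x ∉ range g := by
    rintro ⟨r, hr⟩
    exact hx ⟨r, (inversionAt y).injective hr⟩
  have himg : ∀ T, inversionAt y '' (F ∩ f '' T) = g '' (f ⁻¹' F ∩ T) := fun T => by
    rw [inter_comm (f ⁻¹' F), hg, image_comp, image_inter_preimage, inter_comm F]
  have hpiece : ∀ a b, IsClosed (g '' (f ⁻¹' F ∩ Icc a b)) ∧
      Outside (g '' (f ⁻¹' F ∩ Icc a b)) (inversionAt y x) := fun a b => by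
    refine ⟨((isCompact_Icc.inter_left (hF.preimage hf.continuous)).image hgc).isClosed, ?_⟩
    refine HasLogOn.mono (LogTrivial.outside ((logTrivial_Icc a b).image isCompact_Icc
      hgc.continuousOn hgi.injOn) fun h' => hgx (image_subset_range g _ h'))
      (image_mono inter_subset_right)
  set T := Ici d ∪ Iic (-d) with hT
  have hfarc : IsClosed (insert 0 (g '' (f ⁻¹' F ∩ T))) :=
    himg T ▸ isClosed_insert_inversionAt (hFT T (isClosed_Ici.union isClosed_Iic))
  have hfar : Outside (insert 0 (g '' (f ⁻¹' F ∩ T))) (inversionAt y x) := by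
    refine outside_of_norm_lt ?_
    rintro _ (rfl | ⟨r, ⟨hr, hrT⟩, rfl⟩)
    · simpa only [map_zero, norm_zero] using hδ0
    · refine hd r hr ?_
      rcases hrT with h' | h'
      · exact (mem_Ici.1 h').trans (le_abs_self r)
      · exact (le_neg.1 h').trans (neg_le_abs r)
  have hmeet1 : (insert 0 (g '' (f ⁻¹' F ∩ T)) ∩ g '' (f ⁻¹' F ∩ Icc c d)).Subsingleton := by
    refine (subsingleton_singleton (a := g d)).anti ?_
    rintro _ ⟨h1, r, ⟨-, hr⟩, rfl⟩
    obtain ⟨r', ⟨-, hr'⟩, hrr⟩ := h1.resolve_left (hg0 r)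
    obtain rfl := hgi hrr
    rcases hr' with h' | h'
    · exact congrArg g (le_antisymm hr.2 h')
    · exact absurd (hr.1.trans h') (not_le.2 hdc1)
  have hmeet2 : ((insert 0 (g '' (f ⁻¹' F ∩ T)) ∪ g '' (f ⁻¹' F ∩ Icc c d)) ∩
      g '' (f ⁻¹' F ∩ Icc (-d) c)).Subsingleton := by
    refine (subsingleton_singleton (a := g (-d))).anti ?_
    rintro _ ⟨h1 | ⟨r', ⟨hr', hr'd⟩, hrr⟩, r, ⟨-, hr⟩, rfl⟩
    · obtain ⟨r', ⟨-, hr'⟩, hrr⟩ := h1.resolve_left (hg0 r)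
      obtain rfl := hgi hrr
      rcases hr' with h' | h'
      · exact absurd (h'.trans hr.2) (not_le.2 hdc2)
      · exact congrArg g (le_antisymm h' hr.1)
    · obtain rfl := hgi hrr
      obtain rfl := le_antisymm hr.2 hr'd.1
      exact absurd hr' hc
  refine HasLogOn.mono (Outside.union (hfarc.union (hpiece c d).1) (hpiece (-d) c).1
    hmeet2.isPreconnected (Outside.union hfarc (hpiece c d).1 hmeet1.isPreconnected hfar
      (hpiece c d).2) (hpiece (-d) c).2) ?_
  rintro _ (rfl | ⟨u, hu, rfl⟩)
  · exact Or.inl (Or.inl (Or.inl rfl))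
  · obtain ⟨r, rfl⟩ := hFf hu
    rcases le_total d r with h1 | h1
    · exact Or.inl (Or.inl (Or.inr ⟨r, ⟨hu, Or.inl h1⟩, rfl⟩))
    rcases le_total r (-d) with h2 | h2
    · exact Or.inl (Or.inl (Or.inr ⟨r, ⟨hu, Or.inr h2⟩, rfl⟩))
    rcases le_total c r with h3 | h3
    · exact Or.inl (Or.inr ⟨r, ⟨hu, h3, h1⟩, rfl⟩)
    · exact Or.inr ⟨r, ⟨hu, h2, h3⟩, rfl⟩

/-- An arc separating the plane is closed. -/
theorem isClosed_range_of_not_isPreconnected_compl {f : ℝ → ℝ × ℝ} (hf : Topology.IsEmbedding f)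
    (h : ¬ IsPreconnected (range f)ᶜ) : IsClosed (range f) := by
  simp only [IsPreconnected, not_forall] at h
  obtain ⟨U, V, hU, hV, hUV, ⟨x, hx, hxU⟩, ⟨y, hy, hyV⟩, hno⟩ := h
  rw [not_nonempty_iff_eq_empty] at hno
  have hsep : Disjoint (nhdsSet ((range f)ᶜ ∩ U)) (nhdsSet ((range f)ᶜ ∩ V)) := by
    refine completely_normal ?_ ?_
    · refine Disjoint.mono_right inter_subset_right (Disjoint.closure_left ?_ hV)
      exact disjoint_left.2 fun w hw hwV => (Set.ext_iff.1 hno w).1 ⟨hw.1, hw.2, hwV⟩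
    · refine Disjoint.mono_left inter_subset_right (Disjoint.closure_right ?_ hU)
      exact disjoint_left.2 fun w hwU hw => (Set.ext_iff.1 hno w).1 ⟨hw.1, hwU, hw.2⟩
  obtain ⟨U', V', hU', hV', hUU', hVV', hd⟩ := separatedNhds_iff_disjoint.2 hsep
  have hxU' : x ∈ U' := hUU' ⟨hx, hxU⟩
  have hyV' : y ∈ V' := hVV' ⟨hy, hyV⟩
  set F := (U' ∪ V')ᶜ
  have hF : IsClosed F := (hU'.union hV').isClosed_compl
  have hFf : F ⊆ range f := by
    refine compl_subset_comm.1 fun w hw => ?_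
    exact (hUV hw).imp (fun h => hUU' ⟨hw, h⟩) fun h => hVV' ⟨hw, h⟩
  by_cases hall : ∀ c, f c ∈ F
  · rwa [(range_subset_iff.2 hall).antisymm hFf]
  obtain ⟨c, hc⟩ := not_forall.1 hall
  have hyU' : ∀ u ∈ U', u ≠ y := fun u hu huy => disjoint_left.1 hd hu (huy ▸ hyV')
  exfalso
  refine not_outside_of_frontier_subset (U := inversionAt y '' U') ?_ ?_ ⟨x, hxU', rfl⟩
    (outside_insert_inversionAt hf hF hFf hc hx hy (hyU' x hxU'))
  · obtain ⟨ε, hε, hgap⟩ := exists_norm_gap hV'.isClosed_compl (not_not.2 hyV')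
    refine isBounded_of_norm_le (R := ε⁻¹) ?_
    rintro _ ⟨u, hu, rfl⟩
    rw [toComplex_inversionAt, norm_inv]
    exact inv_anti₀ hε (hgap u fun huV => disjoint_left.1 hd hu huV)
  · intro w hw
    by_cases h0 : w = 0
    · exact Or.inl h0
    refine Or.inr ⟨(inversionAt y).symm w, ?_, (inversionAt y).apply_symm_apply w⟩
    have hcl := symm_mem_closure_of_mem_closure_image hw.1 h0
    rintro (h' | h')
    · refine hw.2 (mem_interior_iff_mem_nhds.2 ?_)
      filter_upwards [(continuousAt_inversionAt_symm h0).preimage_mem_nhds (hU'.mem_nhds h')]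
        with z hz
      exact ⟨_, hz, (inversionAt y).apply_symm_apply z⟩
    · obtain ⟨z, hzV, hzU⟩ := mem_closure_iff.1 hcl V' hV' h'
      exact disjoint_left.1 hd hzU hzV

theorem exists_exit {f : ℝ → ℝ × ℝ} (hf : Continuous f) {C : Set (ℝ × ℝ)} (hC : IsOpen C) {d : ℝ}
    (hd : ∀ r, f r ∈ C → |r| ≤ d) {r : ℝ} (hr : f r ∈ C) :
    ∃ t, r < t ∧ f t ∈ frontier C ∧ ∀ u ∈ Ico r t, f u ∈ C := by
  set D := {u | r ≤ u ∧ f u ∉ C}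
  have hDc : IsClosed D := isClosed_Ici.inter (hC.isClosed_compl.preimage hf)
  have hDn : D.Nonempty := by
    have hrd := (le_abs_self r).trans (hd r hr)
    refine ⟨d + 1, by linarith, fun h => ?_⟩
    linarith [(le_abs_self _).trans (hd _ h)]
  have hDb : BddBelow D := ⟨r, fun u hu => hu.1⟩
  have hD := hDc.isLeast_csInf hDn hDb
  set t := sInf D
  have hrt : r < t := hD.1.1.lt_of_ne fun h => hD.1.2 (h ▸ hr)
  have hIco : ∀ u ∈ Ico r t, f u ∈ C := fun u hu => by
    by_contra h
    exact (hD.2 ⟨hu.1, h⟩).not_gt hu.2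
  refine ⟨t, hrt, ?_, hIco⟩
  rw [hC.frontier_eq]
  exact ⟨map_mem_closure hf (by rw [closure_Ico hrt.ne]; exact right_mem_Icc.2 hrt.le) hIco,
    hD.1.2⟩

theorem IsBigon.isChord_of_mem {p q : ℝ → ℝ × ℝ} {C : Set (ℝ × ℝ)} (h : IsBigon p q C)
    {f : ℝ → ℝ × ℝ} (hf : Continuous f) (hinj : Function.Injective f)
    (hp : (p '' Icc 0 1 ∩ range f).Subsingleton) (hq : (q '' Icc 0 1 ∩ range f).Subsingleton)
    (h0 : p 0 ∉ range f) (h1 : p 1 ∉ range f) {s t : ℝ} (hst : s < t)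
    (hs : f s ∈ p '' Icc 0 1) (ht : f t ∈ q '' Icc 0 1) (hIoo : ∀ r ∈ Ioo s t, f r ∈ C)
    (hexit : ∀ r, f r ∈ C → (∃ u < r, f u ∈ frontier C) ∧ ∃ u > r, f u ∈ frontier C) :
    ∃ τ κ, IsChord p q C f s t τ κ := by
  obtain ⟨τ, hτ, hτs⟩ := hs
  obtain ⟨κ, hκ, hκt⟩ := ht
  have hJ : ∀ r, f r ∈ p '' Icc 0 1 ∪ q '' Icc 0 1 → r = s ∨ r = t := by
    rintro r (hr | hr)
    · exact Or.inl (hinj (hp ⟨hr, r, rfl⟩ ⟨⟨τ, hτ, hτs⟩, s, rfl⟩))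
    · exact Or.inr (hinj (hq ⟨hr, r, rfl⟩ ⟨⟨κ, hκ, hκt⟩, t, rfl⟩))
  refine ⟨τ, κ, hf, hinj, hst, ?_, ?_, hτs.symm, hκt.symm, fun r => ⟨fun hr => ?_, hIoo r⟩, hJ⟩
  · exact ⟨hτ.1.lt_of_ne (by rintro rfl; exact h0 ⟨s, hτs.symm⟩),
      hτ.2.lt_of_ne (by rintro rfl; exact h1 ⟨s, hτs.symm⟩)⟩
  · exact ⟨hκ.1.lt_of_ne (by rintro rfl; exact h0 ⟨t, (hκt.symm.trans h.start_eq.symm)⟩),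
      hκ.2.lt_of_ne (by rintro rfl; exact h1 ⟨t, (hκt.symm.trans h.end_eq.symm)⟩)⟩
  · obtain ⟨⟨u, hur, hu⟩, u', hru, hu'⟩ := hexit r hr
    have e1 := hJ u (h.frontier_subset hu)
    have e2 := hJ u' (h.frontier_subset hu')
    constructor
    · rcases e1 with rfl | rfl
      · exact hur
      · exact hst.trans hur
    · rcases e2 with rfl | rfl
      · exact hru.trans hst
      · exact hru

theorem IsBigon.exists_isChord {p q : ℝ → ℝ × ℝ} {C : Set (ℝ × ℝ)} (h : IsBigon p q C)
    {f : ℝ → ℝ × ℝ} (hf : Topology.IsEmbedding f) (hfc : IsClosed (range f))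
    (hp : (p '' Icc 0 1 ∩ range f).Subsingleton) (hq : (q '' Icc 0 1 ∩ range f).Subsingleton)
    (h0 : p 0 ∉ range f) (h1 : p 1 ∉ range f) {r₀ : ℝ} (hr₀ : f r₀ ∈ C) :
    ∃ (g : ℝ → ℝ × ℝ) (s t τ κ : ℝ), range g = range f ∧ IsChord p q C g s t τ κ := by
  have hK : IsCompact (f ⁻¹' closure C) :=
    Topology.IsClosedEmbedding.isCompact_preimage ⟨hf, hfc⟩ h.isBounded.isCompact_closure
  obtain ⟨d, hd⟩ := hK.isBounded.exists_norm_le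
  have hd1 : ∀ r, f r ∈ C → |r| ≤ d := fun r hr => hd r (subset_closure hr)
  have hfn : Continuous fun r => f (-r) := hf.continuous.comp continuous_neg
  have hd2 : ∀ r, f (-r) ∈ C → |r| ≤ d := fun r hr => abs_neg r ▸ hd1 _ hr
  have hback : ∀ r, f r ∈ C → ∃ u < r, f u ∈ frontier C ∧ ∀ v ∈ Ioc u r, f v ∈ C := by
    intro r hr
    obtain ⟨u, hu, hfu, hI⟩ := exists_exit hfn h.isOpen hd2 (r := -r) (by rwa [neg_neg])
    refine ⟨-u, neg_lt.1 hu, hfu, fun v hv => ?_⟩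
    have := hI (-v) ⟨neg_le_neg hv.2, neg_lt.1 hv.1⟩
    rwa [neg_neg] at this
  have hexit : ∀ r, f r ∈ C → (∃ u < r, f u ∈ frontier C) ∧ ∃ u > r, f u ∈ frontier C := by
    intro r hr
    obtain ⟨u, hu, hfu, -⟩ := hback r hr
    obtain ⟨u', hu', hfu', -⟩ := exists_exit hf.continuous h.isOpen hd1 hr
    exact ⟨⟨u, hu, hfu⟩, u', hu', hfu'⟩
  obtain ⟨s, hs, hfs, hIs⟩ := hback r₀ hr₀
  obtain ⟨t, ht, hft, hIt⟩ := exists_exit hf.continuous h.isOpen hd1 hr₀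
  have hst := hs.trans ht
  have hIoo : ∀ r ∈ Ioo s t, f r ∈ C := fun r hr => by
    rcases le_total r r₀ with hle | hle
    · exact hIs r ⟨hr.1, hle⟩
    · exact hIt r ⟨hle, hr.2⟩
  rcases h.frontier_subset hfs, h.frontier_subset hft with ⟨hs' | hs', ht' | ht'⟩
  · exact absurd (hf.injective (hp ⟨hs', s, rfl⟩ ⟨ht', t, rfl⟩)) hst.ne
  · obtain ⟨τ, κ, hch⟩ := h.isChord_of_mem hf.continuous hf.injective hp hq h0 h1 hst hs' ht' hIoo
      hexit
    exact ⟨f, s, t, τ, κ, rfl, hch⟩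
  · have hrange : range (fun r => f (-r)) = range f := (neg_surjective (G := ℝ)).range_comp f
    obtain ⟨τ, κ, hch⟩ := h.isChord_of_mem (f := fun r => f (-r)) hfn
      (hf.injective.comp neg_injective) (hrange.symm ▸ hp) (hrange.symm ▸ hq)
      (hrange.symm ▸ h0) (hrange.symm ▸ h1) (neg_lt_neg hst) (by rwa [neg_neg])
      (by rwa [neg_neg]) (fun r hr => hIoo _ ⟨lt_neg.1 hr.2, neg_lt.1 hr.1⟩) (fun r hr => by
        obtain ⟨⟨u, hu, hfu⟩, u', hu', hfu'⟩ := hexit _ hr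
        exact ⟨⟨-u', neg_lt.1 hu', by rwa [neg_neg]⟩, -u, lt_neg.1 hu, by rwa [neg_neg]⟩)
    exact ⟨_, _, _, τ, κ, hrange, hch⟩
  · exact absurd (hf.injective (hq ⟨hs', s, rfl⟩ ⟨ht', t, rfl⟩)) hst.ne

theorem IsBigon.isCrossingSystem {ι : Type*} {p q : ℝ → ℝ × ℝ} {C : Set (ℝ × ℝ)}
    (h : IsBigon p q C) {f : ι → ℝ → ℝ × ℝ} {s t τ κ : ι → ℝ}
    (hf : ∀ i, IsChord p q C (f i) (s i) (t i) (τ i) (κ i)) (hτ : Function.Injective τ)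
    (hmeet : ∀ i j, i ≠ j → (range (f i) ∩ range (f j)).Subsingleton)
    (hcross : ∀ i j, i ≠ j → ∀ x ∈ range (f i) ∩ range (f j),
      IsLocalCross (range (f i)) (range (f j)) x) :
    IsCrossingSystem (fun i => range (f i) ∩ C) (fun i => Function.invFun (f i)) τ := by
  have hinv : ∀ i r, Function.invFun (f i) (f i r) = r := fun i =>
    Function.leftInverse_invFun (hf i).injective
  refine ⟨hτ, ?_, fun i j hij => (hmeet i j hij).anti
    (inter_subset_inter inter_subset_left inter_subset_left), ?_, ?_⟩
  · rintro i _ ⟨⟨r, rfl⟩, -⟩ _ ⟨⟨r', rfl⟩, -⟩ hrr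
    rw [hinv, hinv] at hrr
    rw [hrr]
  · rintro i j k v ⟨⟨α, rfl⟩, hC⟩ ⟨⟨β, hβ⟩, -⟩ hk hvk
    obtain ⟨r, hr, hr'⟩ := (hf i).exists_crossing_of_between h (hf j) (hf k)
      (((hf i).mem_iff α).1 hC) (((hf j).mem_iff β).1 (hβ ▸ hC)) hβ.symm
      (by rwa [uIoo_of_lt (hk.1.trans hk.2)])
    have hrC := ((hf k).mem_iff r).2 hr
    rcases hr' with ⟨y, hy, hyr⟩ | ⟨y, hy, hyr⟩
    · refine Or.inl ⟨f k r, ⟨⟨⟨y, hyr⟩, hrC⟩, ⟨r, rfl⟩, hrC⟩, ?_⟩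
      simp only [← hyr, hinv]
      refine hy.2.lt_of_ne ?_
      rintro rfl
      exact hvk ⟨⟨r, hyr.symm⟩, hC⟩
    · refine Or.inr ⟨f k r, ⟨⟨⟨y, hyr⟩, hrC⟩, ⟨r, rfl⟩, hrC⟩, ?_⟩
      rw [← hyr, ← hβ]
      simp only [hinv]
      refine hy.2.lt_of_ne ?_
      rintro rfl
      exact hvk ⟨⟨r, hyr.symm.trans hβ⟩, hC⟩
  · rintro i j k v hij ⟨⟨α, rfl⟩, hC⟩ ⟨⟨β, hβ⟩, -⟩ hk ⟨_, ⟨⟨⟨x, rfl⟩, hxC⟩, ⟨ξ, hξ⟩, -⟩, hlt⟩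
    have hik : i ≠ k := by rintro rfl; exact hk left_mem_uIcc
    dsimp only at hlt
    rw [hinv, hinv] at hlt
    obtain ⟨r, hr, y, hy, hyr⟩ := (hf i).exists_crossing_of_notMem h (hf j) (hf k)
      (hmeet i j hij) (hmeet i k hik) (hcross i k hik _ ⟨⟨x, rfl⟩, ξ, hξ⟩) (hτ.ne hij)
      (((hf i).mem_iff α).1 hC) (((hf j).mem_iff β).1 (hβ ▸ hC)) hβ.symm hk
      ⟨(((hf i).mem_iff x).1 hxC).1, hlt⟩ hξ
    have hrC := ((hf k).mem_iff r).2 hr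
    refine ⟨f k r, ⟨⟨⟨y, hyr⟩, hrC⟩, ⟨r, rfl⟩, hrC⟩, ?_⟩
    rw [← hyr, ← hβ]
    simp only [hinv]
    exact hy.2

theorem Path.extend_image_Icc {X : Type*} [TopologicalSpace X] {a b : X} (γ : Path a b) :
    γ.extend '' Icc 0 1 = range γ := by
  ext x
  constructor
  · rintro ⟨t, ht, rfl⟩
    exact ⟨⟨t, ht⟩, (γ.extend_apply ht).symm⟩
  · rintro ⟨t, rfl⟩
    exact ⟨t, t.2, γ.extend_apply t.2⟩

theorem Path.extend_injOn {X : Type*} [TopologicalSpace X] {a b : X} {γ : Path a b}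
    (hγ : Function.Injective γ) : InjOn γ.extend (Icc 0 1) := fun s hs t ht hst => by
  rw [γ.extend_apply hs, γ.extend_apply ht] at hst
  exact congrArg Subtype.val (hγ hst)

theorem frontier_connectedComponentIn_subset {X : Type*} [TopologicalSpace X]
    [LocallyConnectedSpace X] {F : Set X} (hF : IsOpen F) (z : X) :
    frontier (connectedComponentIn F z) ⊆ Fᶜ := by
  intro x hx hxF
  rw [hF.connectedComponentIn.frontier_eq] at hx
  obtain ⟨y, hyx, hyz⟩ := mem_closure_iff.1 hx.1 _ (hF.connectedComponentIn (x := x))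
    (mem_connectedComponentIn hxF)
  refine hx.2 ?_
  rw [connectedComponentIn_eq hyz, ← connectedComponentIn_eq hyx]
  exact mem_connectedComponentIn hxF

theorem Path.isBigon {a b : ℝ × ℝ} {P Q : Path a b} (hP : Function.Injective P)
    (hQ : Function.Injective Q) (hPQ : range P ∩ range Q = {a, b}) {z : ℝ × ℝ}
    (hz : z ∉ range P ∪ range Q)
    (hb : Bornology.IsBounded (connectedComponentIn (range P ∪ range Q)ᶜ z)) :
    IsBigon P.extend Q.extend (connectedComponentIn (range P ∪ range Q)ᶜ z) := by
  have hopen : IsOpen (range P ∪ range Q)ᶜ :=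
    ((isCompact_range P.continuous).union (isCompact_range Q.continuous)).isClosed.isOpen_compl
  refine ⟨P.continuous_extend, Q.continuous_extend, Path.extend_injOn hP, Path.extend_injOn hQ,
    by simp, by simp, ?_, hopen.connectedComponentIn, hb, ⟨z, mem_connectedComponentIn hz⟩, ?_, ?_⟩
  · intro s hs t ht hst
    have hmem : P.extend s ∈ range P ∩ range Q :=
      ⟨P.extend_image_Icc ▸ mem_image_of_mem _ hs,
        hst ▸ Q.extend_image_Icc ▸ mem_image_of_mem _ ht⟩
    rw [hPQ] at hmem
    rcases hmem with h | h
    · exact Or.inl (Path.extend_injOn hP hs (by simp) (h.trans P.extend_zero.symm))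
    · exact Or.inr (Path.extend_injOn hP hs (by simp) (h.trans P.extend_one.symm))
  · rw [P.extend_image_Icc, Q.extend_image_Icc]
    simpa only [compl_compl] using frontier_connectedComponentIn_subset hopen z
  · rw [P.extend_image_Icc, Q.extend_image_Icc]
    exact disjoint_left.2 fun x hx => connectedComponentIn_subset _ _ hx

namespace ArcArrangement

theorem finite_vertexSet (A : ArcArrangement) : A.vertexSet.Finite := by
  refine (A.finite.biUnion fun S hS => A.finite.biUnion (t := fun T => ⋃ _ : S ≠ T, S ∩ T)
    fun T hT => finite_iUnion fun hST => (A.meet_once S hS T hT hST).finite).subset ?_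
  rintro x ⟨S, hS, T, hT, hST, hx⟩
  exact mem_biUnion hS (mem_biUnion hT (mem_iUnion.2 ⟨hST, hx⟩))

theorem vertexSlide_self (A : ArcArrangement) {a b v : ℝ × ℝ} (γ : Path a b)
    (hv : v ∈ A.vertexSet) : VertexSlide A γ γ := by
  refine ⟨v, (A.vertexSet \ {v})ᶜ, hv, (A.finite_vertexSet.sdiff).isClosed.isOpen_compl, ?_,
    fun t ht => absurd rfl ht⟩
  ext x
  simp only [mem_inter_iff, mem_compl_iff, mem_sdiff, mem_singleton_iff, not_and, not_not]
  exact ⟨fun h => h.2 h.1, fun h => ⟨h ▸ hv, fun _ => h⟩⟩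

theorem exists_chord (A : ArcArrangement) {a b : ℝ × ℝ} (ha : a ∉ ⋃₀ A.arcs) (hb : b ∉ ⋃₀ A.arcs)
    {P Q : Path a b} (hP : A.IsDualPath P) (hQ : A.IsDualPath Q) {C : Set (ℝ × ℝ)}
    (h : IsBigon P.extend Q.extend C) {S : Set (ℝ × ℝ)} (hS : S ∈ A.arcs)
    (hSC : (S ∩ C).Nonempty) :
    ∃ (f : ℝ → ℝ × ℝ) (s t τ κ : ℝ), range f = S ∧ IsChord P.extend Q.extend C f s t τ κ := by
  obtain ⟨f, hf, rfl⟩ := A.isArc S hS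
  obtain ⟨_, ⟨r, rfl⟩, hr⟩ := hSC
  refine h.exists_isChord hf (isClosed_range_of_not_isPreconnected_compl hf (A.separates _ hS))
    (P.extend_image_Icc ▸ hP.2 _ hS) (Q.extend_image_Icc ▸ hQ.2 _ hS) ?_ ?_ hr
  · rw [P.extend_zero]
    exact fun h' => ha ⟨_, hS, h'⟩
  · rw [P.extend_one]
    exact fun h' => hb ⟨_, hS, h'⟩

end ArcArrangement

theorem Topology.IsEmbedding.exists_of_range_eq {f g : ℝ → ℝ × ℝ} (hf : Topology.IsEmbedding f)
    (hg : Continuous g) (hfg : range g = range f) {s t : ℝ} (hst : s ≤ t) :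
    ∃ s' t', f s' = g s ∧ f t' = g t ∧
      ∀ r ∈ Ioo (min s' t') (max s' t'), ∃ u ∈ Ioo s t, f r = g u := by
  choose φ hφ using fun r => hfg.subset (mem_range_self r)
  have hφc : Continuous φ := hf.isInducing.continuous_iff.2 (by
    rwa [show f ∘ φ = g from funext hφ])
  refine ⟨φ s, φ t, hφ s, hφ t, fun r hr => ?_⟩
  obtain ⟨u, hu, rfl⟩ : r ∈ φ '' Ioo s t := by
    rcases le_total (φ s) (φ t) with h | h
    · rw [min_eq_left h, max_eq_right h] at hr
      exact intermediate_value_Ioo hst hφc.continuousOn hr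
    · rw [min_eq_right h, max_eq_left h] at hr
      exact intermediate_value_Ioo' hst hφc.continuousOn hr
  exact ⟨u, hu, hφ u⟩

/-- Let `A` be an arrangement of arcs in which every two arcs cross, and
let `P`, `Q` be internally disjoint dual paths with the same endpoints bounding a
(bounded) disc `Δ`.  If `Δ` contains a vertex of the arrangement, then it contains a
vertex `v` such that along every arc through `v`, no other vertex lies between the
arc's crossing with `P` and `v` (so `v` is the first vertex encountered entering `Δ`
through `P` along each of its arcs); consequently `v` can be slid across `P`. -/
theorem exists_slidable_vertex (A : ArcArrangement)
    (hcross : ∀ S ∈ A.arcs, ∀ T ∈ A.arcs, S ≠ T → (S ∩ T).Nonempty)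
    (a b : ℝ × ℝ) (ha : a ∉ ⋃₀ A.arcs) (hb : b ∉ ⋃₀ A.arcs)
    (P Q : Path a b) (hP : A.IsDualPath P) (hQ : A.IsDualPath Q)
    (hPinj : Function.Injective ⇑P) (hQinj : Function.Injective ⇑Q)
    (hint : Set.range ⇑P ∩ Set.range ⇑Q = {a, b})
    (z : ℝ × ℝ) (hz : z ∉ Set.range ⇑P ∪ Set.range ⇑Q)
    (Δ : Set (ℝ × ℝ))
    (hΔ : Δ = closure (connectedComponentIn (Set.range ⇑P ∪ Set.range ⇑Q)ᶜ z))
    (hbdd : Bornology.IsBounded Δ)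
    (hvx : (A.vertexSet ∩ Δ).Nonempty) :
    ∃ v ∈ A.vertexSet ∩ Δ,
      (∀ S ∈ A.arcs, v ∈ S →
        ∀ f : ℝ → ℝ × ℝ, Topology.IsEmbedding f → Set.range f = S →
          ∃ s t : ℝ, f s ∈ Set.range ⇑P ∧ f t = v ∧
            ∀ r : ℝ, r ∈ Set.Ioo (min s t) (max s t) →
              f r ∈ Δ ∧ f r ∉ A.vertexSet) ∧
      ∃ P' : Path a b, VertexSlide A P P' ∧ A.IsDualPath P' := by
  set C := connectedComponentIn (range P ∪ range Q)ᶜ z with hC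
  have hCΔ : C ⊆ Δ := hΔ ▸ subset_closure
  have hB : IsBigon P.extend Q.extend C := Path.isBigon hPinj hQinj hint hz (hbdd.subset hCΔ)
  have hvC : ∀ v ∈ A.vertexSet ∩ Δ, v ∈ C := by
    rintro v ⟨hv, hvΔ⟩
    by_contra hvC
    have hfr : v ∈ frontier C := by
      rw [hB.isOpen.frontier_eq]
      exact ⟨hΔ ▸ hvΔ, hvC⟩
    have := hB.frontier_subset hfr
    rw [P.extend_image_Icc, Q.extend_image_Icc] at this
    exact this.elim (fun h => disjoint_left.1 hP.1 h hv) fun h => disjoint_left.1 hQ.1 h hv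
  let ι := {S : Set (ℝ × ℝ) // S ∈ A.arcs ∧ (S ∩ C).Nonempty}
  have : Finite ι := (A.finite.subset fun S hS => hS.1 : {S | S ∈ A.arcs ∧ (S ∩ C).Nonempty}.Finite)
  choose f s t τ κ hrange hch using fun i : ι => A.exists_chord ha hb hP hQ hB i.2.1 i.2.2
  have hτ : Function.Injective τ := by
    intro i j hij
    by_contra hne
    refine disjoint_left.1 hP.1 (P.extend_image_Icc ▸ mem_image_of_mem P.extend
      (Ioo_subset_Icc_self (hch i).fst_mem)) ⟨i.1, i.2.1, j.1, j.2.1, fun h => hne (Subtype.ext h),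
        ?_, ?_⟩
    · rw [← hrange i]
      exact ⟨s i, (hch i).apply_start⟩
    · rw [← hrange j, hij]
      exact ⟨s j, (hch j).apply_start⟩
  have hcs := hB.isCrossingSystem hch hτ
    (fun i j hij => by
      rw [hrange, hrange]
      exact A.meet_once _ i.2.1 _ j.2.1 fun h => hij (Subtype.ext h))
    (fun i j hij => by
      rw [hrange, hrange]
      exact A.meet_cross _ i.2.1 _ j.2.1 fun h => hij (Subtype.ext h))
  obtain ⟨w, hw⟩ := hvx
  obtain ⟨S₀, hS₀, T₀, hT₀, hST₀, hwS, hwT⟩ := id hw.1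
  have hwC := hvC w hw
  obtain ⟨v, ⟨i, j, hij, hvi, hvj⟩, hfirst⟩ := hcs.exists_slidable
    ⟨w, ⟨S₀, hS₀, w, hwS, hwC⟩, ⟨T₀, hT₀, w, hwT, hwC⟩, fun h => hST₀ (congrArg Subtype.val h),
      ⟨by rwa [hrange], hwC⟩, by rwa [hrange], hwC⟩
  have hv : v ∈ A.vertexSet :=
    ⟨i.1, i.2.1, j.1, j.2.1, fun h => hij (Subtype.ext h), hrange i ▸ hvi.1, hrange j ▸ hvj.1⟩
  refine ⟨v, ⟨hv, hCΔ hvi.2⟩, ?_, P, A.vertexSlide_self P hv, hP⟩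
  intro S hS hvS g hg hgS
  let m : ι := ⟨S, hS, v, hvS, hvi.2⟩
  have hvm : v ∈ range (f m) := by rwa [hrange]
  obtain ⟨γ, hγ⟩ := id hvm
  have hγI : γ ∈ Ioo (s m) (t m) := ((hch m).mem_iff γ).1 (hγ ▸ hvi.2)
  obtain ⟨s', t', hs', ht', hr⟩ := hg.exists_of_range_eq (hch m).continuous
    ((hrange m).trans hgS.symm) hγI.1.le
  refine ⟨s', t', ?_, ht'.trans hγ, fun r hr' => ?_⟩
  · rw [hs', (hch m).apply_start, ← P.extend_image_Icc]
    exact mem_image_of_mem _ (Ioo_subset_Icc_self (hch m).fst_mem)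
  · obtain ⟨u, hu, hur⟩ := hr r hr'
    have huC : f m u ∈ C := ((hch m).mem_iff u).2 ⟨hu.1, hu.2.trans hγI.2⟩
    rw [hur]
    refine ⟨hCΔ huC, ?_⟩
    rintro ⟨T, hT, T', hT', hTT', huT, huT'⟩
    obtain ⟨k, hkm, huk⟩ : ∃ k : ι, k ≠ m ∧ f m u ∈ k.1 := by
      by_cases h : T = S
      · exact ⟨⟨T', hT', _, huT', huC⟩,
          fun h' => hTT' (h.trans (congrArg Subtype.val h').symm), huT'⟩
      · exact ⟨⟨T, hT, _, huT, huC⟩, fun h' => h (congrArg Subtype.val h'), huT⟩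
    refine hfirst m ⟨hvm, hvi.2⟩ k hkm
      ⟨f m u, ⟨⟨⟨u, rfl⟩, huC⟩, by rwa [hrange], huC⟩, ?_⟩
    rw [← hγ]
    dsimp only
    rw [Function.leftInverse_invFun (hch m).injective, Function.leftInverse_invFun (hch m).injective]
    exact hu.2
end
end
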